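/- arXiv:2006.15361 — 3 statements merged into one kernel-verified Lean document; each statement's English description precedes it below -/
import Mathlib

section
/- Let d be a squarefree positive integer with discriminant Δ_d > (29524500000005)², and let F = ℚ(√d). Then there is no positive definite classic universal quadratic 𝒪_F-lattice of rank 7. -/
noncomputable section

/-- `Δ_d`: the discriminant of `ℚ(√d)` for squarefree `d > 1`. -/
def Delta (d : ℕ) : ℕ := if d % 4 = 1 then d else 4 * d

/-- `ω_d`, viewed as a real number (with `√d > 0`). -/
def omegaR (d : ℕ) : ℝ := if d % 4 = 1 then (1 + Real.sqrt d) / 2 else Real.sqrt d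

/-- The conjugate `ω̄_d`, viewed as a real number. -/
def omegaConjR (d : ℕ) : ℝ := if d % 4 = 1 then (1 - Real.sqrt d) / 2 else -Real.sqrt d

/-- `F = ℚ(√d)`, realized as an intermediate field of `ℝ/ℚ` via the embedding with `√d > 0`. -/
def Fd (d : ℕ) : IntermediateField ℚ ℝ := IntermediateField.adjoin ℚ {Real.sqrt d}

/-- The ring of integers `𝒪_F` of `F = ℚ(√d)`. -/
abbrev Od (d : ℕ) := NumberField.RingOfIntegers (Fd d)

/-- An element of `F` is totally positive if its image under each of the
(two) real embeddings of `F` is positive. -/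
def TotPos {d : ℕ} (x : Fd d) : Prop := ∀ σ : Fd d →ₐ[ℚ] ℝ, 0 < σ x

/-- The conjugate `x̄` of `x ∈ F = ℚ(√d)`, as a real number: `x̄ = tr(x) - x`. -/
def conjR {d : ℕ} (x : Fd d) : ℝ := ((Algebra.trace ℚ (Fd d) x : ℚ) : ℝ) - (x : ℝ)

/-- A (not necessarily classic) quadratic `𝒪_F`-lattice: a finitely generated
`𝒪_F`-module `L` with a quadratic map `Q : L → 𝒪_F` whose associated form
`B(x,y) = (Q(x+y)-Q(x)-Q(y))/2` (with values a priori in `F`) is symmetric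
bilinear and satisfies `B(x,x) = Q(x)`. -/
structure QuadLattice (d : ℕ) where
  carrier : Type
  [isAddCommGroup : AddCommGroup carrier]
  [isModule : Module (Od d) carrier]
  finite : Module.Finite (Od d) carrier
  Q : carrier → Od d
  B : carrier → carrier → Fd d
  B_symm : ∀ x y, B x y = B y x
  B_add_left : ∀ x y z, B (x + y) z = B x z + B y z
  B_smul_left : ∀ (a : Od d) (x y : carrier), B (a • x) y = (a : Fd d) * B x y
  B_self : ∀ x, B x x = (Q x : Fd d)
  B_def : ∀ x y, 2 * B x y = (Q (x + y) : Fd d) - (Q x : Fd d) - (Q y : Fd d)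

attribute [instance] QuadLattice.isAddCommGroup QuadLattice.isModule

namespace QuadLattice

variable {d : ℕ} (L : QuadLattice d)

/-- `L` is classic if the bilinear form takes values in `𝒪_F`. -/
def IsClassic : Prop := ∀ x y, L.B x y ∈ integralClosure ℤ (Fd d)

/-- `L` is positive definite if `Q(x)` is totally positive for all `x ≠ 0`. -/
def PosDef : Prop := ∀ x : L.carrier, x ≠ 0 → TotPos (L.Q x : Fd d)

/-- `L` is universal if `Q(L) = 𝒪_F⁺ ∪ {0}`. -/
def Universal : Prop :=
  (Set.range fun v => L.Q v) = {a : Od d | TotPos (a : Fd d)} ∪ {0}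

end QuadLattice

/-- A positive diagonal ternary form represents a small integer only with small coordinates. -/
theorem sq_add_sq_add_mul_sq_ne {p q r n : ℤ} (hp : 0 < p) (hq : 0 < q) (hr : 0 < r) (hn : n < 16)
    (h : ∀ x ∈ Finset.range 4, ∀ y ∈ Finset.range 4, ∀ z ∈ Finset.range 4,
      p * (x : ℤ) ^ 2 + q * (y : ℤ) ^ 2 + r * (z : ℤ) ^ 2 ≠ n) (x y z : ℤ) :
    p * x ^ 2 + q * y ^ 2 + r * z ^ 2 ≠ n := by
  have aux : ∀ {s u m : ℤ}, 0 < s → 0 ≤ m → s * u ^ 2 + m = n → u.natAbs ∈ Finset.range 4 := by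
    intro s u m hs hm hu
    have : |u| < 4 := abs_lt_of_sq_lt_sq (by nlinarith [sq_nonneg u]) (by norm_num)
    rw [Int.abs_eq_natAbs] at this
    rw [Finset.mem_range]
    exact_mod_cast this
  intro he
  have hx := mul_nonneg hp.le (sq_nonneg x)
  have hy := mul_nonneg hq.le (sq_nonneg y)
  have hz := mul_nonneg hr.le (sq_nonneg z)
  refine h x.natAbs (aux hp (add_nonneg hy hz) (by linarith)) y.natAbs
    (aux hq (add_nonneg hx hz) (by linarith)) z.natAbs (aux hr (add_nonneg hx hy) (by linarith)) ?_
  simpa using he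

theorem exists_eq_mul_of_mul_eq_sq {s m z : ℤ} (hs : Squarefree s) (h : s * m = z ^ 2) :
    ∃ w, z = s * w ∧ m = s * w ^ 2 := by
  obtain ⟨w, rfl⟩ := (hs.dvd_pow_iff_dvd two_ne_zero).1 ⟨m, h.symm⟩
  exact ⟨w, rfl, mul_left_cancel₀ hs.ne_zero (by linear_combination h)⟩

/-- Escalation: an almost positive semidefinite integral form on vectors of norms `0, 1, 2, …` has a
nonsingular `4 × 4` Gram matrix on vectors of norm at most `15`. -/
theorem exists_det_ne_zero_of_diag (t : ℕ → ℕ → ℤ) (hsymm : ∀ i j, t i j = t j i)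
    (hdiag : ∀ i, t i i = i)
    (hpos : ∀ k ≤ 15, ∀ a b c : ℤ, |a| ≤ 10 → |b| ≤ 10 → |c| ≤ 10 →
      0 ≤ a ^ 2 + 2 * b ^ 2 + k * c ^ 2 + 2 * (a * b * t 1 2) + 2 * (a * c * t 1 k)
        + 2 * (b * c * t 2 k)) :
    ∃ f : Fin 4 → ℕ, (∀ i, f i ≤ 15) ∧ (Matrix.of fun i j => t (f i) (f j)).det ≠ 0 := by
  have key : ∀ k l : ℕ, k ≤ 15 → l ≤ 15 →
      (Matrix.of fun i j => t ((![1, 2, k, l] : Fin 4 → ℕ) i) ((![1, 2, k, l] : Fin 4 → ℕ) j)).det ≠ 0 →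
      ∃ f : Fin 4 → ℕ, (∀ i, f i ≤ 15) ∧ (Matrix.of fun i j => t (f i) (f j)).det ≠ 0 := by
    intro k l hk hl h
    refine ⟨![1, 2, k, l], ?_, h⟩
    intro i
    fin_cases i <;> simp <;> omega
  have hdet : ∀ k l : ℕ,
      (Matrix.of fun i j => t ((![1, 2, k, l] : Fin 4 → ℕ) i) ((![1, 2, k, l] : Fin 4 → ℕ) j)).det =
      (2 * k - k * t 1 2 ^ 2 - 2 * t 1 k ^ 2 - t 2 k ^ 2 + 2 * t 1 2 * t 1 k * t 2 k) * l
       - ((2 * k - t 2 k ^ 2) * t 1 l ^ 2 + (k - t 1 k ^ 2) * t 2 l ^ 2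
          + (2 - t 1 2 ^ 2) * t k l ^ 2
          + 2 * (t 1 k * t 2 k - k * t 1 2) * t 1 l * t 2 l
          + 2 * (t 1 2 * t 2 k - 2 * t 1 k) * t 1 l * t k l
          + 2 * (t 1 2 * t 1 k - t 2 k) * t 2 l * t k l) := by
    intro k l
    rw [Matrix.det_succ_row_zero]
    simp [Fin.sum_univ_succ, Matrix.det_fin_three, Fin.succAbove]
    rw [hsymm 2 1, hsymm k 1, hsymm k 2, hsymm l 1, hsymm l 2, hsymm l k]
    simp only [hdiag]
    push_cast
    ring
  have h1 := hpos 2 (by norm_num) 1 1 0 (by norm_num) (by norm_num) (by norm_num)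
  have h2 := hpos 2 (by norm_num) 1 (-1) 0 (by norm_num) (by norm_num) (by norm_num)
  norm_num at h1 h2
  by_cases h12 : t 1 2 = 0
  · have e1 := hpos 5 (by norm_num) 1 0 1 (by norm_num) (by norm_num) (by norm_num)
    have e2 := hpos 5 (by norm_num) 1 0 (-1) (by norm_num) (by norm_num) (by norm_num)
    have e3 := hpos 5 (by norm_num) 0 1 1 (by norm_num) (by norm_num) (by norm_num)
    have e4 := hpos 5 (by norm_num) 0 1 (-1) (by norm_num) (by norm_num) (by norm_num)
    norm_num at e1 e2 e3 e4
    have e5 := hpos 5 (by norm_num) (-2 * t 1 5) (-t 2 5) 2 (by rw [abs_le]; omega)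
      (by rw [abs_le]; omega) (by norm_num)
    rw [h12] at e5
    push_cast at e5
    have hdet' : ∀ l, 2 * (Matrix.of fun i j => t ((![1, 2, 5, l] : Fin 4 → ℕ) i)
        ((![1, 2, 5, l] : Fin 4 → ℕ) j)).det = (10 - 2 * t 1 5 ^ 2 - t 2 5 ^ 2)
          * (2 * l - 2 * t 1 l ^ 2 - t 2 l ^ 2)
          - (2 * t 5 l - 2 * t 1 5 * t 1 l - t 2 5 * t 2 l) ^ 2 := by
      intro l
      rw [hdet, h12]
      push_cast
      ring
    generalize t 1 5 = a at *
    generalize t 2 5 = b at *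
    have e6 : 2 * a ^ 2 + b ^ 2 ≤ 10 := by linarith
    clear e1 e2 e3 e4 e5
    have hn : 2 * a ^ 2 + b ^ 2 ≠ 10 := fun h =>
      sq_add_sq_add_mul_sq_ne (p := 2) (q := 1) (r := 11) (n := 10) (by norm_num)
        (by norm_num) (by norm_num) (by norm_num) (by decide) a b 0 (by linear_combination h)
    have hb : |b| ≤ 3 := by
      have : |b| < 4 := abs_lt_of_sq_lt_sq (by nlinarith [sq_nonneg a]) (by norm_num)
      omega
    have ha : |a| ≤ 2 := by
      have : |a| < 3 := abs_lt_of_sq_lt_sq (by nlinarith [sq_nonneg b]) (by norm_num)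
      omega
    have ha2 : a ^ 2 = 0 ∨ a ^ 2 = 1 ∨ a ^ 2 = 4 := by
      rw [abs_le] at ha
      obtain ⟨h, h'⟩ := ha
      interval_cases a <;> simp
    have hb2 : b ^ 2 = 0 ∨ b ^ 2 = 1 ∨ b ^ 2 = 4 ∨ b ^ 2 = 9 := by
      rw [abs_le] at hb
      obtain ⟨h, h'⟩ := hb
      interval_cases b <;> simp
    have hD : ∃ D, 10 - 2 * a ^ 2 - b ^ 2 = D ∧ (D = 1 ∨ D = 2 ∨ D = 4 ∨ D = 6 ∨ D = 7 ∨ D = 8 ∨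
        D = 9 ∨ D = 10) := ⟨_, rfl, by omega⟩
    obtain ⟨D, hD, hcases⟩ := hD
    rw [hD] at hdet'
    have key' : ∀ l : ℕ, l ≤ 15 → (∀ x y z : ℤ, D * (2 * l - 2 * x ^ 2 - y ^ 2) ≠ z ^ 2) →
        ∃ f : Fin 4 → ℕ, (∀ i, f i ≤ 15) ∧ (Matrix.of fun i j => t (f i) (f j)).det ≠ 0 :=
      fun l hl h => key 5 l (by norm_num) hl fun h0 =>
        h _ _ _ (sub_eq_zero.1 ((hdet' l).symm.trans (by rw [h0, mul_zero])))
    have even : ∀ {y m : ℤ}, y ^ 2 = 2 * m → ∃ w, y = 2 * w ∧ m = 2 * w ^ 2 := fun h =>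
      exists_eq_mul_of_mul_eq_sq Int.prime_two.squarefree h.symm
    have h7 : ∀ x y z : ℤ, 2 * 7 - 2 * x ^ 2 - y ^ 2 ≠ z ^ 2 := fun x y z h =>
      sq_add_sq_add_mul_sq_ne (p := 2) (q := 1) (r := 1) (n := 14) (by norm_num)
        (by norm_num) (by norm_num) (by norm_num) (by decide) x y z (by linear_combination -h)
    have h14 : ∀ x y z : ℤ, 2 * 14 - 2 * x ^ 2 - y ^ 2 ≠ 2 * z ^ 2 := fun x y z h => by
      obtain ⟨v, rfl, -⟩ := even (show y ^ 2 = 2 * (14 - x ^ 2 - z ^ 2) by linear_combination -h)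
      exact sq_add_sq_add_mul_sq_ne (p := 1) (q := 1) (r := 2) (n := 14) (by norm_num)
        (by norm_num) (by norm_num) (by norm_num) (by decide) x z v (by linarith)
    have two := Int.prime_two.squarefree
    have sqf : Squarefree (6 : ℤ) ∧ Squarefree (10 : ℤ) := by
      constructor
      · exact Int.squarefree_natCast.2 ((Nat.squarefree_mul (m := 2) (n := 3) (by norm_num)).2
          ⟨Nat.prime_two.squarefree, Nat.prime_three.squarefree⟩)
      · exact Int.squarefree_natCast.2 ((Nat.squarefree_mul (m := 2) (n := 5) (by norm_num)).2
          ⟨Nat.prime_two.squarefree, Nat.prime_five.squarefree⟩)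
    rcases hcases with rfl | rfl | rfl | rfl | rfl | rfl | rfl | rfl
    · exact key' 7 (by norm_num) fun x y z h => h7 x y z (by push_cast at h; linarith)
    · refine key' 14 (by norm_num) fun x y z h => ?_
      obtain ⟨w, -, hw⟩ := exists_eq_mul_of_mul_eq_sq two h
      exact h14 x y w (by push_cast at hw; linarith)
    · refine key' 7 (by norm_num) fun x y z h => ?_
      obtain ⟨w, rfl, -⟩ := even (h.symm.trans (show _ = 2 * (2 * _) by rw [← mul_assoc]; rfl))
      exact h7 x y w (by push_cast at h; linarith)
    · refine key' 10 (by norm_num) fun x y z h => ?_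
      obtain ⟨w, -, hw⟩ := exists_eq_mul_of_mul_eq_sq sqf.1 h
      push_cast at hw
      obtain ⟨v, rfl, -⟩ := even (show y ^ 2 = 2 * (10 - x ^ 2 - 3 * w ^ 2) by linear_combination -hw)
      exact sq_add_sq_add_mul_sq_ne (p := 1) (q := 2) (r := 3) (n := 10) (by norm_num)
        (by norm_num) (by norm_num) (by norm_num) (by decide) x v w (by linarith)
    · refine key' 7 (by norm_num) fun x y z h => ?_
      obtain ⟨w, -, hw⟩ := exists_eq_mul_of_mul_eq_sq
        (Int.prime_iff_natAbs_prime.2 (by norm_num)).squarefree h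
      push_cast at hw
      exact sq_add_sq_add_mul_sq_ne (p := 2) (q := 1) (r := 7) (n := 14) (by norm_num)
        (by norm_num) (by norm_num) (by norm_num) (by decide) x y w (by linarith)
    · refine key' 14 (by norm_num) fun x y z h => ?_
      obtain ⟨w, rfl, -⟩ := even (h.symm.trans (show _ = 2 * (4 * _) by rw [← mul_assoc]; rfl))
      obtain ⟨v, rfl, -⟩ := even (show w ^ 2 = 2 * (2 * 14 - 2 * x ^ 2 - y ^ 2) by
        push_cast at h; linarith)
      exact h14 x y v (by push_cast at h; linarith)
    · refine key' 7 (by norm_num) fun x y z h => ?_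
      obtain ⟨w, rfl, -⟩ := exists_eq_mul_of_mul_eq_sq Int.prime_three.squarefree
        ((show (3 : ℤ) * (3 * _) = _ by rw [← mul_assoc]; rfl).trans h)
      exact h7 x y w (by push_cast at h; linarith)
    · refine key' 10 (by norm_num) fun x y z h => ?_
      obtain ⟨w, -, hw⟩ := exists_eq_mul_of_mul_eq_sq sqf.2 h
      push_cast at hw
      obtain ⟨v, rfl, -⟩ := even (show y ^ 2 = 2 * (10 - x ^ 2 - 5 * w ^ 2) by linear_combination -hw)
      exact sq_add_sq_add_mul_sq_ne (p := 1) (q := 2) (r := 5) (n := 10) (by norm_num)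
        (by norm_num) (by norm_num) (by norm_num) (by decide) x v w (by linarith)
  · have hs : t 1 2 ^ 2 = 1 := by
      have : t 1 2 = 1 ∨ t 1 2 = -1 := by omega
      rcases this with h | h <;> rw [h] <;> norm_num
    have hc0 : 0 ≤ 3 - t 1 3 ^ 2 - (t 2 3 - t 1 2 * t 1 3) ^ 2 := by
      have e1 := hpos 3 (by norm_num) 1 0 1 (by norm_num) (by norm_num) (by norm_num)
      have e2 := hpos 3 (by norm_num) 1 0 (-1) (by norm_num) (by norm_num) (by norm_num)
      have e3 := hpos 3 (by norm_num) 0 1 1 (by norm_num) (by norm_num) (by norm_num)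
      have e4 := hpos 3 (by norm_num) 0 1 (-1) (by norm_num) (by norm_num) (by norm_num)
      norm_num at e1 e2 e3 e4
      have : t 1 2 = 1 ∨ t 1 2 = -1 := by omega
      have e5 := hpos 3 (by norm_num) (-t 1 3 + (t 2 3 - t 1 2 * t 1 3) * t 1 2)
        (-(t 2 3 - t 1 2 * t 1 3)) 1
        (by rcases this with h | h <;> rw [h, abs_le] <;> omega)
        (by rcases this with h | h <;> rw [h, abs_le] <;> omega) (by norm_num)
      push_cast at e5
      linear_combination e5 - (t 2 3 - t 1 2 * t 1 3) ^ 2 * hs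
    generalize hb : t 2 3 - t 1 2 * t 1 3 = b at hc0
    generalize hc : 3 - t 1 3 ^ 2 - b ^ 2 = c at hc0
    have hdet' : ∀ l, (Matrix.of fun i j => t ((![1, 2, 3, l] : Fin 4 → ℕ) i)
        ((![1, 2, 3, l] : Fin 4 → ℕ) j)).det = c * l - c * t 1 l ^ 2
          - c * (t 2 l - t 1 2 * t 1 l) ^ 2
          - (t 3 l - t 1 3 * t 1 l - b * (t 2 l - t 1 2 * t 1 l)) ^ 2 := by
      intro l
      rw [hdet, ← hc, ← hb]
      push_cast
      have : t 1 2 = 1 ∨ t 1 2 = -1 := by omega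
      rcases this with h | h <;> rw [h] <;> ring
    have hc3 : c ≤ 3 := by nlinarith [sq_nonneg (t 1 3), sq_nonneg b]
    have hcn : c ≠ 0 := by
      rintro rfl
      exact sq_add_sq_add_mul_sq_ne (p := 1) (q := 1) (r := 4) (n := 3) (by norm_num)
        (by norm_num) (by norm_num) (by norm_num) (by decide) (t 1 3) b 0 (by linear_combination -hc)
    obtain rfl | rfl | rfl : c = 1 ∨ c = 2 ∨ c = 3 := by omega
    · refine key 3 7 (by norm_num) (by norm_num) fun h => ?_
      rw [hdet'] at h
      refine sq_add_sq_add_mul_sq_ne (p := 1) (q := 1) (r := 1) (n := 7) (by norm_num)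
        (by norm_num) (by norm_num) (by norm_num) (by decide) (t 1 7) (t 2 7 - t 1 2 * t 1 7) (t 3 7 - t 1 3 * t 1 7 - b * (t 2 7 - t 1 2 * t 1 7)) ?_
      push_cast at h
      linear_combination -h
    · refine key 3 14 (by norm_num) (by norm_num) fun h => ?_
      rw [hdet'] at h
      push_cast at h
      obtain ⟨w, -, hw⟩ := exists_eq_mul_of_mul_eq_sq (s := 2)
        (m := 14 - t 1 14 ^ 2 - (t 2 14 - t 1 2 * t 1 14) ^ 2)
        (z := t 3 14 - t 1 3 * t 1 14 - b * (t 2 14 - t 1 2 * t 1 14)) Int.prime_two.squarefree (by linear_combination h)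
      exact sq_add_sq_add_mul_sq_ne (p := 1) (q := 1) (r := 2) (n := 14) (by norm_num)
        (by norm_num) (by norm_num) (by norm_num) (by decide) (t 1 14) (t 2 14 - t 1 2 * t 1 14) w (by linear_combination -hw)
    · refine key 3 6 (by norm_num) (by norm_num) fun h => ?_
      rw [hdet'] at h
      push_cast at h
      obtain ⟨w, -, hw⟩ := exists_eq_mul_of_mul_eq_sq (s := 3)
        (m := 6 - t 1 6 ^ 2 - (t 2 6 - t 1 2 * t 1 6) ^ 2)
        (z := t 3 6 - t 1 3 * t 1 6 - b * (t 2 6 - t 1 2 * t 1 6)) Int.prime_three.squarefree (by linear_combination h)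
      exact sq_add_sq_add_mul_sq_ne (p := 1) (q := 1) (r := 3) (n := 6) (by norm_num)
        (by norm_num) (by norm_num) (by norm_num) (by decide) (t 1 6) (t 2 6 - t 1 2 * t 1 6) w (by linear_combination -hw)

open Matrix in
/-- An integral matrix which is almost positive semidefinite and nonsingular is positive definite. -/
theorem pos_of_det_ne_zero (T : Matrix (Fin 4) (Fin 4) ℤ) (hsymm : ∀ i j, T i j = T j i)
    (hdiag : ∀ i, T i i ≤ 15) (hdet : T.det ≠ 0) {ε : ℝ} (hε : ε ≤ 1 / 10 ^ 6)
    (hpos : ∀ c : Fin 4 → ℝ, -ε * ∑ i, c i ^ 2 ≤ ∑ i, ∑ j, c i * c j * T i j)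
    (c : Fin 4 → ℝ) (hc : c ≠ 0) : 0 < ∑ i, ∑ j, c i * c j * (T i j : ℝ) := by
  set A : Matrix (Fin 4) (Fin 4) ℝ := T.map (Int.cast : ℤ → ℝ) with hAdef
  have hA : A.IsHermitian := by
    ext i j
    simp [A, hsymm i j]
  have hdetA : |A.det| ≥ 1 := by
    have : A.det = (T.det : ℤ) := ((Int.castRingHom ℝ).map_det T).symm
    rw [this]
    exact_mod_cast Int.one_le_abs hdet
  have hform : ∀ v : Fin 4 → ℝ, v ⬝ᵥ A *ᵥ v = ∑ i, ∑ j, v i * v j * (T i j : ℝ) := by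
    intro v
    simp only [dotProduct, mulVec, Finset.mul_sum, A, Matrix.map_apply]
    exact Finset.sum_congr rfl fun i _ => Finset.sum_congr rfl fun j _ => by ring
  have hlow : ∀ i, -ε ≤ hA.eigenvalues i := by
    intro i
    have h1 : ∑ j, (hA.eigenvectorBasis i).ofLp j ^ 2 = 1 := by
      have := hA.eigenvectorBasis.orthonormal.1 i
      rw [EuclideanSpace.norm_eq, Real.sqrt_eq_one] at this
      simpa using this
    have h2 := hpos (hA.eigenvectorBasis i).ofLp
    rw [h1, ← hform] at h2
    rw [hA.eigenvalues_eq]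
    simpa using h2
  have htr : ∑ i, hA.eigenvalues i ≤ 60 := by
    have h1 := hA.trace_eq_sum_eigenvalues
    have h2 : A.trace ≤ ∑ i : Fin 4, (15 : ℝ) :=
      Finset.sum_le_sum fun i _ => by simpa [A] using (by exact_mod_cast hdiag i : (T i i : ℝ) ≤ 15)
    rw [h1] at h2
    norm_num at h2
    simpa using h2
  have hup : ∀ i, |hA.eigenvalues i| ≤ 61 := by
    intro i
    rw [Fin.sum_univ_four] at htr
    have h0 := hlow 0
    have h1 := hlow 1
    have h2 := hlow 2
    have h3 := hlow 3
    rw [abs_le]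
    fin_cases i <;> constructor <;> simp at * <;> linarith
  have hP : A.PosDef := by
    rw [hA.posDef_iff_eigenvalues_pos]
    intro i
    by_contra! hneg
    have hi : |hA.eigenvalues i| ≤ 1 / 10 ^ 6 := by
      rw [abs_le]
      constructor <;> linarith [hlow i]
    rw [hA.det_eq_prod_eigenvalues, ← Finset.mul_prod_erase _ _ (Finset.mem_univ i), abs_mul,
      Finset.abs_prod] at hdetA
    have h2 : ∏ j ∈ Finset.univ.erase i, |hA.eigenvalues j| ≤ 61 ^ 3 := by
      refine (Finset.prod_le_prod (fun _ _ => abs_nonneg _) fun j _ => hup j).trans ?_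
      simp
    have := mul_le_mul hi h2 (Finset.prod_nonneg fun _ _ => abs_nonneg _) (by positivity)
    norm_num at this hdetA
    linarith
  have := hP.dotProduct_mulVec_pos hc
  rw [← hform]
  simpa using this

section QuadraticField

open IntermediateField NumberField

/-- The element `√d` of `ℚ(√d)`. -/
def sqrtd (d : ℕ) : Fd d := AdjoinSimple.gen ℚ (Real.sqrt d)

theorem coe_sqrtd (d : ℕ) : ((sqrtd d : Fd d) : ℝ) = Real.sqrt d := rfl

theorem sqrtd_sq (d : ℕ) : sqrtd d ^ 2 = (d : Fd d) := by
  apply Subtype.ext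
  push_cast
  rw [coe_sqrtd, Real.sq_sqrt (Nat.cast_nonneg d)]

theorem isIntegral_sqrt (d : ℕ) : IsIntegral ℚ (Real.sqrt d) :=
  ⟨Polynomial.X ^ 2 - Polynomial.C (d : ℚ), Polynomial.monic_X_pow_sub_C _ two_ne_zero, by simp⟩

theorem exists_conj (d : ℕ) (hd : ¬IsSquare d) :
    ∃ τ : Fd d →ₐ[ℚ] ℝ, τ (sqrtd d) = -Real.sqrt d := by
  have hintegral := isIntegral_sqrt d
  have hmin : minpoly ℚ (Real.sqrt d) = Polynomial.X ^ 2 - Polynomial.C (d : ℚ) := by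
    refine (Polynomial.eq_of_monic_of_dvd_of_natDegree_le (minpoly.monic hintegral)
      (Polynomial.monic_X_pow_sub_C _ two_ne_zero) (minpoly.dvd _ _ (by simp)) ?_).symm
    rw [Polynomial.natDegree_X_pow_sub_C, minpoly.two_le_natDegree_iff hintegral]
    exact irrational_sqrt_natCast_iff.2 hd
  refine ⟨(adjoin.powerBasis hintegral).lift (-Real.sqrt d) ?_, ?_⟩
  · rw [adjoin.powerBasis_gen, minpoly_gen, hmin]
    simp
  · exact (adjoin.powerBasis hintegral).lift_gen _ _

theorem exists_rat_add_rat_mul (d : ℕ) (a : Fd d) :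
    ∃ p q : ℚ, a = algebraMap ℚ (Fd d) p + algebraMap ℚ (Fd d) q * sqrtd d := by
  have ha : (a : ℝ) ∈ Algebra.adjoin ℚ {Real.sqrt d} := by
    rw [← adjoin_simple_toSubalgebra_of_isAlgebraic (isIntegral_sqrt d).isAlgebraic]
    exact a.2
  obtain ⟨p, q, h⟩ : ∃ p q : ℚ, (a : ℝ) = p + q * Real.sqrt d := by
    generalize (a : ℝ) = r at ha
    induction ha using Algebra.adjoin_induction with
    | mem x hx => exact ⟨0, 1, by simp [Set.mem_singleton_iff.1 hx]⟩
    | algebraMap r => exact ⟨r, 0, by simp⟩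
    | add x y _ _ hx hy =>
      obtain ⟨p, q, rfl⟩ := hx
      obtain ⟨r, s, rfl⟩ := hy
      exact ⟨p + r, q + s, by push_cast; ring⟩
    | mul x y _ _ hx hy =>
      obtain ⟨p, q, rfl⟩ := hx
      obtain ⟨r, s, rfl⟩ := hy
      refine ⟨p * r + q * s * d, p * s + q * r, ?_⟩
      push_cast
      linear_combination (q * s : ℝ) * Real.sq_sqrt (Nat.cast_nonneg (α := ℝ) d)
  refine ⟨p, q, Subtype.ext ?_⟩
  rw [h]
  simp [coe_sqrtd]

theorem algHom_eq_or (d : ℕ) {τ : Fd d →ₐ[ℚ] ℝ} (hτ : τ (sqrtd d) = -Real.sqrt d)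
    (σ : Fd d →ₐ[ℚ] ℝ) : (∀ a, σ a = a) ∨ ∀ a, σ a = τ a := by
  have h : σ (sqrtd d) = Real.sqrt d ∨ σ (sqrtd d) = -Real.sqrt d := by
    rw [← sq_eq_sq_iff_eq_or_eq_neg, ← map_pow, sqrtd_sq, Real.sq_sqrt (Nat.cast_nonneg d),
      map_natCast]
  refine h.imp (fun h a => ?_) fun h a => ?_
  · obtain ⟨p, q, rfl⟩ := exists_rat_add_rat_mul d a
    simp [h, coe_sqrtd]
  · obtain ⟨p, q, rfl⟩ := exists_rat_add_rat_mul d a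
    simp [h, hτ]

theorem exists_int_of_isIntegral {r : ℚ} (h : IsIntegral ℤ r) : ∃ m : ℤ, r = m := by
  obtain ⟨m, hm⟩ := IsIntegrallyClosed.isIntegral_iff.1 h
  exact ⟨m, by simpa using hm.symm⟩

/-- The difference of an integer of `ℚ(√d)` and its conjugate is a multiple of `√Δ_d`. -/
theorem sub_conj_eq (d : ℕ) (hd : Squarefree d) {τ : Fd d →ₐ[ℚ] ℝ}
    (hτ : τ (sqrtd d) = -Real.sqrt d) {a : Fd d} (ha : IsIntegral ℤ a) :
    ∃ t : ℤ, (a : ℝ) - τ a = t * Real.sqrt (Delta d) := by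
  obtain ⟨p, q, rfl⟩ := exists_rat_add_rat_mul d a
  have hi1 := ha.map (Fd d).val
  have hi2 := ha.map τ
  have hsq := Real.sq_sqrt (Nat.cast_nonneg (α := ℝ) d)
  obtain ⟨m, hm⟩ : ∃ m : ℤ, 2 * p = m := by
    refine exists_int_of_isIntegral ?_
    rw [← isIntegral_algebraMap_iff (B := ℝ) (algebraMap ℚ ℝ).injective]
    have e : algebraMap ℚ ℝ (2 * p) =
        (Fd d).val (algebraMap ℚ (Fd d) p + algebraMap ℚ (Fd d) q * sqrtd d) +
          τ (algebraMap ℚ (Fd d) p + algebraMap ℚ (Fd d) q * sqrtd d) := by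
      simp [hτ, coe_sqrtd]
      ring
    rw [e]
    exact hi1.add hi2
  obtain ⟨n, hn⟩ : ∃ n : ℤ, p ^ 2 - d * q ^ 2 = n := by
    refine exists_int_of_isIntegral ?_
    rw [← isIntegral_algebraMap_iff (B := ℝ) (algebraMap ℚ ℝ).injective]
    have e : algebraMap ℚ ℝ (p ^ 2 - d * q ^ 2) =
        (Fd d).val (algebraMap ℚ (Fd d) p + algebraMap ℚ (Fd d) q * sqrtd d) *
          τ (algebraMap ℚ (Fd d) p + algebraMap ℚ (Fd d) q * sqrtd d) := by
      simp [hτ, coe_sqrtd]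
      linear_combination (q : ℝ) ^ 2 * hsq
    rw [e]
    exact hi1.mul hi2
  have hd0 : (d : ℚ) ≠ 0 := by exact_mod_cast hd.ne_zero
  obtain ⟨k, hk⟩ : ∃ k : ℤ, 2 * q = k := by
    have hsq' : (d * (2 * q)) ^ 2 = ((d * (m ^ 2 - 4 * n) : ℤ) : ℚ) := by
      push_cast
      rw [← hm, ← hn]
      ring
    obtain ⟨j, hj⟩ := exists_int_of_isIntegral (r := d * (2 * q))
      (.of_pow two_pos (by rw [hsq']; exact isIntegral_algebraMap))
    rw [hj] at hsq'
    obtain ⟨k, rfl⟩ := ((Int.squarefree_natCast.2 hd).dvd_pow_iff_dvd two_ne_zero).1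
      ⟨_, show j ^ 2 = d * (m ^ 2 - 4 * n) by exact_mod_cast hsq'⟩
    exact ⟨k, mul_left_cancel₀ hd0 (by rw [hj]; push_cast; rfl)⟩
  have hmk : m ^ 2 - d * k ^ 2 = 4 * n := by
    have : (m : ℚ) ^ 2 - d * k ^ 2 = 4 * n := by
      rw [← hm, ← hk, ← hn]
      ring
    exact_mod_cast this
  have hval : ((algebraMap ℚ (Fd d) p + algebraMap ℚ (Fd d) q * sqrtd d : Fd d) : ℝ)
      - τ (algebraMap ℚ (Fd d) p + algebraMap ℚ (Fd d) q * sqrtd d) = k * Real.sqrt d := by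
    have : (k : ℝ) = 2 * q := by exact_mod_cast hk.symm
    simp [hτ, coe_sqrtd, this]
    ring
  rw [hval, Delta]
  split_ifs with h1
  · exact ⟨k, rfl⟩
  · obtain ⟨l, rfl⟩ : (2 : ℤ) ∣ k := by
      by_contra hk2
      have h4 : ¬ 4 ∣ d := fun h => by
        simpa using hd 2 h
      have e1 : k ^ 2 % 4 = 1 := by
        obtain ⟨l, rfl⟩ : Odd k := by rwa [← Int.not_even_iff_odd, even_iff_two_dvd]
        ring_nf
        omega
      have e2 : m ^ 2 % 4 = 0 ∨ m ^ 2 % 4 = 1 := by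
        rcases Int.even_or_odd' m with ⟨l, rfl | rfl⟩ <;> ring_nf <;> omega
      have e3 : (d * k ^ 2) % 4 = (d : ℤ) % 4 := by rw [Int.mul_emod, e1]; simp
      omega
    refine ⟨l, ?_⟩
    push_cast
    rw [Real.sqrt_mul (by norm_num), show Real.sqrt 4 = 2 by
      rw [show (4 : ℝ) = 2 ^ 2 by norm_num]; exact Real.sqrt_sq (by norm_num)]
    ring

theorem exists_int_of_conj_eq (d : ℕ) (hd : 0 < d) {τ : Fd d →ₐ[ℚ] ℝ}
    (hτ : τ (sqrtd d) = -Real.sqrt d) {a : Fd d} (ha : IsIntegral ℤ a) (h : (a : ℝ) = τ a) :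
    ∃ m : ℤ, (a : ℝ) = m := by
  obtain ⟨p, q, rfl⟩ := exists_rat_add_rat_mul d a
  have hpos : 0 < Real.sqrt d := by positivity
  have hq : (q : ℝ) = 0 := by
    simp [hτ, coe_sqrtd] at h
    nlinarith
  have hq0 : q = 0 := by exact_mod_cast hq
  subst hq0
  rw [map_zero, zero_mul, add_zero] at ha ⊢
  obtain ⟨m, rfl⟩ := exists_int_of_isIntegral
    ((isIntegral_algebraMap_iff (algebraMap ℚ (Fd d)).injective).1 ha)
  exact ⟨m, by simp⟩

/-- There is an integer of `ℚ(√d)` with conjugate in `(0, 1]` and difference `√Δ_d`. -/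
theorem exists_omega (d : ℕ) {τ : Fd d →ₐ[ℚ] ℝ}
    (hτ : τ (sqrtd d) = -Real.sqrt d) :
    ∃ α : Od d, ((α : Fd d) : ℝ) - τ α = Real.sqrt (Delta d) ∧ 0 < τ α ∧ τ α ≤ 1 := by
  suffices h : ∃ ω : Od d, ((ω : Fd d) : ℝ) - τ ω = Real.sqrt (Delta d) by
    obtain ⟨ω, hω⟩ := h
    refine ⟨ω - (⌈τ ω⌉ - 1 : ℤ), ?_, ?_, ?_⟩
    · push_cast
      simp
      linarith
    · simp
      linarith [Int.ceil_lt_add_one (τ ω)]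
    · simp
      linarith [Int.le_ceil (τ ω)]
  have hs : IsIntegral ℤ (sqrtd d) :=
    ⟨Polynomial.X ^ 2 - Polynomial.C (d : ℤ), Polynomial.monic_X_pow_sub_C _ two_ne_zero,
      by simp [sqrtd_sq]⟩
  rw [Delta]
  split_ifs with h
  · obtain ⟨n, hn⟩ : ∃ n : ℤ, (d : ℤ) = 4 * n + 1 := ⟨d / 4, by omega⟩
    have hn' : (d : ℝ) = 4 * n + 1 := by exact_mod_cast hn
    obtain ⟨q, hq⟩ : ∃ q : ℚ, (q : ℝ) = 1 / 2 := ⟨1 / 2, by norm_num⟩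
    have hω : IsIntegral ℤ (algebraMap ℚ (Fd d) q + algebraMap ℚ (Fd d) q * sqrtd d) := by
      refine ⟨Polynomial.X ^ 2 - Polynomial.X - Polynomial.C n, by monicity!, ?_⟩
      apply Subtype.ext
      rw [Polynomial.eval₂_sub, Polynomial.eval₂_C]
      simp [coe_sqrtd, hq]
      linear_combination (1 / 4) * Real.sq_sqrt (Nat.cast_nonneg (α := ℝ) d) + 1 / 4 * hn'
    obtain ⟨ω, h⟩ : ∃ ω : Od d, (ω : Fd d) = _ :=
      IsIntegralClosure.isIntegral_iff (A := Od d).1 hω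
    refine ⟨ω, ?_⟩
    rw [h]
    simp [hτ, coe_sqrtd, hq]
    ring
  · obtain ⟨ω, h⟩ : ∃ ω : Od d, (ω : Fd d) = _ :=
      IsIntegralClosure.isIntegral_iff (A := Od d).1 hs
    refine ⟨ω, ?_⟩
    rw [h, hτ, coe_sqrtd]
    push_cast
    rw [Real.sqrt_mul (by norm_num), show Real.sqrt 4 = 2 by
      rw [show (4 : ℝ) = 2 ^ 2 by norm_num]; exact Real.sqrt_sq (by norm_num)]
    ring

end QuadraticField

namespace QuadLattice

variable {d : ℕ} (L : QuadLattice d)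

theorem B_sum_smul_left {ι : Type*} (s : Finset ι) (a : ι → Od d) (u : ι → L.carrier)
    (y : L.carrier) : L.B (∑ i ∈ s, a i • u i) y = ∑ i ∈ s, (a i : Fd d) * L.B (u i) y := by
  induction s using Finset.cons_induction with
  | empty => simpa using L.B_smul_left 0 0 y
  | cons i s hi ih => rw [Finset.sum_cons, L.B_add_left, ih, L.B_smul_left, Finset.sum_cons]

theorem gram_self {ι : Type*} [Fintype ι] (σ : Fd d →ₐ[ℚ] ℝ) (a : ι → Od d) (u : ι → L.carrier) :
    σ (L.Q (∑ i, a i • u i)) = ∑ i, ∑ j, σ (a i) * σ (a j) * σ (L.B (u i) (u j)) := by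
  rw [← L.B_self, B_sum_smul_left, map_sum]
  refine Finset.sum_congr rfl fun i _ => ?_
  rw [L.B_symm, B_sum_smul_left, map_mul, map_sum, Finset.mul_sum]
  refine Finset.sum_congr rfl fun j _ => ?_
  rw [map_mul, L.B_symm]
  ring

theorem Q_zero : (L.Q 0 : Fd d) = 0 := by
  rw [← L.B_self]
  simpa using L.B_smul_left 0 0 0

variable {L}

theorem PosDef.Q_nonneg (hpd : L.PosDef) (σ : Fd d →ₐ[ℚ] ℝ) (x : L.carrier) : 0 ≤ σ (L.Q x) := by
  by_cases hx : x = 0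
  · rw [hx, L.Q_zero, map_zero]
  · exact (hpd x hx σ).le

/-- The Gram matrix of a family of vectors is positive semidefinite in each real embedding. -/
theorem PosDef.gram_nonneg (hpd : L.PosDef) (σ : Fd d →ₐ[ℚ] ℝ) {ι : Type*} [Fintype ι]
    (u : ι → L.carrier) (c : ι → ℝ) :
    0 ≤ ∑ i, ∑ j, c i * c j * σ (L.B (u i) (u j)) := by
  have hrat : ∀ r : ι → ℚ, 0 ≤ ∑ i, ∑ j, (r i : ℝ) * r j * σ (L.B (u i) (u j)) := by
    intro r
    obtain ⟨⟨b, hb⟩, h⟩ := IsLocalization.exist_integer_multiples_of_finite (nonZeroDivisors ℤ) r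
    choose n hn using h
    have hn' : ∀ i, (n i : ℝ) = b * r i := by
      intro i
      have := hn i
      simp at this
      exact_mod_cast this
    have hQ := hpd.Q_nonneg σ (∑ i, (n i : Od d) • u i)
    rw [gram_self] at hQ
    have hb0 : (0 : ℝ) < b ^ 2 := by
      have : (b : ℝ) ≠ 0 := by exact_mod_cast nonZeroDivisors.ne_zero hb
      positivity
    refine nonneg_of_mul_nonneg_right (hQ.trans_eq ?_) hb0
    rw [Finset.mul_sum]
    refine Finset.sum_congr rfl fun i _ => ?_
    rw [Finset.mul_sum]
    refine Finset.sum_congr rfl fun j _ => ?_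
    simp [hn']
    ring
  have hdense : DenseRange (Pi.map fun (_ : ι) (r : ℚ) => (r : ℝ)) :=
    DenseRange.piMap fun _ => Rat.denseRange_cast
  refine hdense.induction_on (p := fun c : ι → ℝ =>
    0 ≤ ∑ i, ∑ j, c i * c j * σ (L.B (u i) (u j))) c ?_ hrat
  exact isClosed_le continuous_const (by fun_prop)

theorem PosDef.gram_three_nonneg (hpd : L.PosDef) (σ : Fd d →ₐ[ℚ] ℝ) (x y z : L.carrier)
    (a b c : ℝ) :
    0 ≤ a ^ 2 * σ (L.Q x) + b ^ 2 * σ (L.Q y) + c ^ 2 * σ (L.Q z) + 2 * (a * b * σ (L.B x y))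
      + 2 * (a * c * σ (L.B x z)) + 2 * (b * c * σ (L.B y z)) := by
  have := hpd.gram_nonneg σ ![x, y, z] ![a, b, c]
  simp [Fin.sum_univ_three] at this
  rw [L.B_symm y x, L.B_symm z x, L.B_symm z y] at this
  simp only [L.B_self] at this
  linarith

theorem PosDef.B_sq_le (hpd : L.PosDef) (σ : Fd d →ₐ[ℚ] ℝ) (x y : L.carrier) :
    σ (L.B x y) ^ 2 ≤ σ (L.Q x) * σ (L.Q y) := by
  have h := discrim_le_zero (a := σ (L.Q x)) (b := 2 * σ (L.B x y)) (c := σ (L.Q y)) fun z => by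
    have := hpd.gram_three_nonneg σ x y 0 z 1 0
    linarith
  rw [discrim] at h
  linarith

theorem Universal.exists_Q_eq (hun : L.Universal) {a : Od d} (ha : a = 0 ∨ TotPos (a : Fd d)) :
    ∃ x, L.Q x = a := by
  have : a ∈ Set.range fun v => L.Q v := by
    rw [hun]
    exact ha.elim Or.inr Or.inl
  exact this

/-- Vectors with small norms have a rational inner product. -/
theorem B_eq_conj (hd : Squarefree d) (hcl : L.IsClassic) {τ : Fd d →ₐ[ℚ] ℝ}
    (hτ : τ (sqrtd d) = -Real.sqrt d) (x y : L.carrier)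
    (h : |(L.B x y : ℝ)| + |τ (L.B x y)| < Real.sqrt (Delta d)) : (L.B x y : ℝ) = τ (L.B x y) := by
  obtain ⟨t, ht⟩ := sub_conj_eq d hd hτ (hcl x y)
  have hs : 0 < Real.sqrt (Delta d) := lt_of_le_of_lt (by positivity) h
  have h1 : |(t : ℝ)| * Real.sqrt (Delta d) < 1 * Real.sqrt (Delta d) := by
    rw [← abs_of_pos hs, ← abs_mul, ← ht, abs_of_pos hs, one_mul]
    exact (abs_sub _ _).trans_lt h
  have h2 : |t| < 1 := by exact_mod_cast lt_of_mul_lt_mul_right h1 hs.le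
  rw [Int.abs_lt_one_iff.1 h2] at ht
  simpa [sub_eq_zero] using ht

end QuadLattice

/-- **Theorem (Statement 0).** If `d` is a squarefree positive integer with
discriminant `Δ_d > 29524500000005²`, then there is no positive definite classic
universal quadratic `𝒪_F`-lattice of rank 7 over `F = ℚ(√d)`. -/
theorem no_classic_universal_lattice_of_rank_seven
    (d : ℕ) (hd : Squarefree d) (hdpos : 0 < d)
    (hΔ : 29524500000005 ^ 2 < Delta d)
    (L : QuadLattice d) (hcl : L.IsClassic) (hpd : L.PosDef) (hun : L.Universal) :
    Module.rank (Od d) L.carrier ≠ 7 := by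
  intro hrank
  have hsq : ¬IsSquare d := by
    rintro ⟨k, rfl⟩
    have hk : k = 1 := by simpa using hd k dvd_rfl
    subst hk
    simp [Delta] at hΔ
  obtain ⟨τ, hτ⟩ := exists_conj d hsq
  obtain ⟨α, hα, hβ0, hβ1⟩ := exists_omega d hτ
  have hs : 29524500000005 < Real.sqrt (Delta d) := by
    rw [Real.lt_sqrt (by norm_num)]
    exact_mod_cast hΔ
  have hrat := fun x y => L.B_eq_conj hd hcl hτ x y
  have hintegral := fun x y => exists_int_of_conj_eq d hdpos hτ (hcl x y)
  have hdiff := fun x y => sub_conj_eq d hd hτ (hcl x y)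
  obtain ⟨ρ, hval⟩ : ∃ ρ : Fd d →ₐ[ℚ] ℝ, ∀ x, ρ x = x := ⟨(Fd d).val, fun _ => rfl⟩
  generalize Real.sqrt (Delta d) = s at *
  generalize hβ : τ α = β at *
  have hα' : ((α : Fd d) : ℝ) = β + s := by linarith
  have hv : ∀ k : ℕ, ∃ x, L.Q x = k := fun k => hun.exists_Q_eq <| by
    rcases k.eq_zero_or_pos with rfl | hk
    · simp
    · right
      intro σ
      simpa using hk
  have hw : ∀ k : ℕ, ∃ x, L.Q x = k * α := fun k => hun.exists_Q_eq <| by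
    rcases k.eq_zero_or_pos with rfl | hk
    · simp
    · right
      intro σ
      have : 0 < σ α := by
        rcases algHom_eq_or d hτ σ with h | h <;> rw [h] <;> linarith
      have hk' : (0 : ℝ) < k := by exact_mod_cast hk
      simpa using mul_pos hk' this
  choose v hv using hv
  choose w hw using hw
  have hvσ : ∀ (σ : Fd d →ₐ[ℚ] ℝ) k, σ (L.Q (v k)) = k := by
    intro σ k
    rw [hv]
    simp
  have hwσ : ∀ (σ : Fd d →ₐ[ℚ] ℝ) k, σ (L.Q (w k)) = k * σ α := by
    intro σ k
    rw [hw]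
    simp
  have hcast : ∀ {k : ℕ}, k ≤ 15 → (k : ℝ) ≤ 15 := fun h => by exact_mod_cast h
  have hvv : ∀ (σ : Fd d →ₐ[ℚ] ℝ) i j, i ≤ 15 → j ≤ 15 → |σ (L.B (v i) (v j))| ≤ 15 := by
    intro σ i j hi hj
    have := hpd.B_sq_le σ (v i) (v j)
    rw [hvσ, hvσ] at this
    exact abs_le_of_sq_le_sq (by
      nlinarith [hcast hi, hcast hj, Nat.cast_nonneg (α := ℝ) i, Nat.cast_nonneg (α := ℝ) j]) (by norm_num)
  have hww : ∀ i j, i ≤ 15 → j ≤ 15 → |τ (L.B (w i) (w j))| ≤ 15 := by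
    intro i j hi hj
    have := hpd.B_sq_le τ (w i) (w j)
    rw [hwσ, hwσ, hβ] at this
    have h1 : i * β ≤ 15 * 1 := mul_le_mul (hcast hi) hβ1 hβ0.le (by norm_num)
    have h2 : j * β ≤ 15 * 1 := mul_le_mul (hcast hj) hβ1 hβ0.le (by norm_num)
    have h3 : 0 ≤ i * β := by positivity
    have h4 : 0 ≤ j * β := by positivity
    exact abs_le_of_sq_le_sq (by nlinarith) (by norm_num)
  have hvw : ∀ i j, i ≤ 15 → j ≤ 15 → (L.B (v i) (w j) : ℝ) = τ (L.B (v i) (w j)) := by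
    intro i j hi hj
    have h1 := hpd.B_sq_le τ (v i) (w j)
    have h2 := hpd.B_sq_le ρ (v i) (w j)
    rw [hvσ, hwσ, hβ] at h1
    rw [hvσ, hwσ, hval, hval, hα'] at h2
    have h3 : (i * j : ℝ) ≤ 15 * 15 :=
      mul_le_mul (hcast hi) (hcast hj) (by positivity) (by norm_num)
    have h4 : (0 : ℝ) ≤ i * j := by positivity
    refine hrat _ _ ((add_le_add (abs_le_of_sq_le_sq (b := s / 4) ?_ ?_)
      (abs_le_of_sq_le_sq (b := s / 4) ?_ ?_)).trans_lt ?_)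
    · have : (i * j : ℝ) * (β + s) ≤ 15 * 15 * (1 + s) :=
        mul_le_mul h3 (by linarith) (by linarith) (by norm_num)
      nlinarith
    · linarith
    · have : (i * j : ℝ) * β ≤ 15 * 15 * 1 := mul_le_mul h3 hβ1 hβ0.le (by norm_num)
      nlinarith
    · linarith
    · linarith
  set m : ℕ → ℕ → ℤ := fun i j => round (L.B (v i) (v j) : ℝ) with hm_def
  have hvv' : ∀ i j, i ≤ 15 → j ≤ 15 → (L.B (v i) (v j) : ℝ) = τ (L.B (v i) (v j)) :=
    fun i j hi hj => hrat _ _ ((add_le_add (hval _ ▸ hvv ρ i j hi hj) (hvv τ i j hi hj)).trans_lt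
      (by linarith))
  have hm : ∀ i j, i ≤ 15 → j ≤ 15 → (m i j : ℝ) = L.B (v i) (v j) := by
    intro i j hi hj
    obtain ⟨k, hk⟩ := hintegral _ _ (hvv' i j hi hj)
    simp only [hm_def]
    rw [hk, round_intCast]
  choose T hT using hdiff
  set t : ℕ → ℕ → ℤ := fun i j => T (w i) (w j) with ht_def
  have ht : ∀ i j, (L.B (w i) (w j) : ℝ) = τ (L.B (w i) (w j)) + t i j * s := by
    intro i j
    linarith [hT (w i) (w j)]
  have hs0 : 0 < s := by linarith
  have hmsymm : ∀ i j, m i j = m j i := fun i j => by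
    simp only [hm_def]
    rw [L.B_symm]
  have hmdiag : ∀ i, m i i = i := fun i => by
    have := hvσ ρ i
    rw [← L.B_self, hval] at this
    simp only [hm_def]
    rw [this, round_natCast]
  have htsymm : ∀ i j, t i j = t j i := fun i j => by
    have h1 := ht i j
    rw [L.B_symm, ht j i] at h1
    have : (t i j : ℝ) = t j i := mul_right_cancel₀ hs0.ne' (by linarith)
    exact_mod_cast this
  have htdiag : ∀ i, t i i = i := fun i => by
    have h1 := ht i i
    have h2 := hwσ ρ i
    have h3 := hwσ τ i
    rw [hval, hval, hα'] at h2
    rw [L.B_self, h2, h3, hβ] at h1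
    have : (t i i : ℝ) = i := mul_right_cancel₀ hs0.ne' (by linarith)
    exact_mod_cast this
  obtain ⟨f, hf, hfdet⟩ := exists_det_ne_zero_of_diag m hmsymm hmdiag
    (fun k hk a b c _ _ _ => by
      have := hpd.gram_three_nonneg ρ (v 1) (v 2) (v k) a b c
      rw [hvσ, hvσ, hvσ, hval, hval, hval, ← hm 1 2 (by norm_num) (by norm_num),
        ← hm 1 k (by norm_num) hk, ← hm 2 k (by norm_num) hk] at this
      push_cast at this
      have h' : (0 : ℝ) ≤ a ^ 2 + 2 * b ^ 2 + k * c ^ 2 + 2 * (a * b * m 1 2)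
        + 2 * (a * c * m 1 k) + 2 * (b * c * m 2 k) := by linarith
      exact_mod_cast h')
  obtain ⟨g, hg, hgdet⟩ := exists_det_ne_zero_of_diag t htsymm htdiag
    (fun k hk a b c ha hb hc => by
      have h0 := hpd.gram_three_nonneg ρ (w 1) (w 2) (w k) a b c
      have h1 := hpd.gram_three_nonneg τ (w 1) (w 2) (w k) a (-b) 0
      have h2 := hpd.gram_three_nonneg τ (w 1) (w 2) (w k) a 0 (-c)
      have h3 := hpd.gram_three_nonneg τ (w 1) (w 2) (w k) 0 b (-c)
      simp only [hwσ, hval, ht, hβ, hα'] at h0 h1 h2 h3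
      have hsq : ∀ {x : ℤ}, |x| ≤ 10 → (x : ℝ) ^ 2 ≤ 100 := by
        intro x hx
        have : x ^ 2 ≤ 10 ^ 2 := sq_le_sq' (abs_le.1 hx).1 (abs_le.1 hx).2
        have : (x : ℝ) ^ 2 ≤ 10 ^ 2 := by exact_mod_cast this
        linarith
      have ha' := mul_le_mul (hsq ha) hβ1 hβ0.le (by norm_num)
      have hb' := mul_le_mul (hsq hb) hβ1 hβ0.le (by norm_num)
      have hc' := mul_le_mul (hcast hk)
        (mul_le_mul (hsq hc) hβ1 hβ0.le (by norm_num)) (by positivity) (by norm_num)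
      push_cast at h0 h1 h2 h3
      set F : ℤ := a ^ 2 + 2 * b ^ 2 + k * c ^ 2 + 2 * (a * b * t 1 2)
        + 2 * (a * c * t 1 k) + 2 * (b * c * t 2 k) with hF
      have hF' : (F : ℝ) = a ^ 2 + 2 * b ^ 2 + k * c ^ 2 + 2 * (a * b * t 1 2)
        + 2 * (a * c * t 1 k) + 2 * (b * c * t 2 k) := by
        rw [hF]
        push_cast
        ring
      have h4 : (-1 : ℝ) * s < F * s := by
        rw [hF']
        linarith
      have h5 : (-1 : ℝ) < F := lt_of_mul_lt_mul_right h4 hs0.le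
      have h6 : -1 < F := by exact_mod_cast h5
      omega)
  have hmpos := pos_of_det_ne_zero (Matrix.of fun i j => m (f i) (f j)) (ε := 0)
    (fun i j => hmsymm _ _) (fun i => by simpa [hmdiag] using hf i) hfdet (by norm_num)
    (fun c => by
      have := hpd.gram_nonneg ρ (v ∘ f) c
      simpa [hval, hm _ _ (hf _) (hf _)] using this)
  have htpos := pos_of_det_ne_zero (Matrix.of fun i j => t (g i) (g j)) (ε := 60 / s)
    (fun i j => htsymm _ _) (fun i => by simpa [htdiag] using hg i) hgdet
    (by rw [div_le_div_iff₀ hs0 (by norm_num)]; linarith)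
    (fun c => by
      have h1 := hpd.gram_nonneg ρ (w ∘ g) c
      have h2 : ∑ i, ∑ j, c i * c j * τ (L.B (w (g i)) (w (g j))) ≤ 60 * ∑ i, c i ^ 2 := by
        calc _ ≤ ∑ i, ∑ j, 15 / 2 * (c i ^ 2 + c j ^ 2) := by
              refine Finset.sum_le_sum fun i _ => Finset.sum_le_sum fun j _ => ?_
              have h3 := hww _ _ (hg i) (hg j)
              refine (le_abs_self _).trans ?_
              rw [abs_mul]
              have h4 : |c i * c j| ≤ 1 / 2 * (c i ^ 2 + c j ^ 2) := by
                rw [abs_le]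
                constructor <;> nlinarith [sq_nonneg (c i + c j), sq_nonneg (c i - c j)]
              have := mul_le_mul h4 h3 (abs_nonneg _) (by positivity)
              linarith
          _ = _ := by
              simp only [Fin.sum_univ_four]
              ring
      simp only [hval, Function.comp_apply, ht, mul_add, Finset.sum_add_distrib, ← mul_assoc,
        ← Finset.sum_mul] at h1
      rw [neg_mul, div_mul_eq_mul_div, ← neg_div, div_le_iff₀ hs0]
      simp only [Matrix.of_apply]
      linarith)
  simp only [Matrix.of_apply] at hmpos htpos
  have hdep : ¬LinearIndependent (Od d) (Sum.elim (v ∘ f) (w ∘ g)) := fun h => by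
    have := h.cardinal_le_rank
    rw [hrank] at this
    norm_num at this
  rw [Fintype.not_linearIndependent_iff] at hdep
  obtain ⟨z, hz, k, hk⟩ := hdep
  have hzero := L.gram_self ρ z (Sum.elim (v ∘ f) (w ∘ g))
  rw [hz, L.Q_zero, map_zero] at hzero
  have hsplit : ∀ i j, ρ (L.B (Sum.elim (v ∘ f) (w ∘ g) i) (Sum.elim (v ∘ f) (w ∘ g) j)) =
      τ (L.B (Sum.elim (v ∘ f) (w ∘ g) i) (Sum.elim (v ∘ f) (w ∘ g) j)) +
        Sum.elim (fun _ => 0) (fun i => Sum.elim (fun _ => 0) (fun j => t (g i) (g j) * s) j) i := by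
    rintro (i | i) (j | j)
    · simp [hval, hvv' _ _ (hf i) (hf j)]
    · simp [hval, hvw _ _ (hf i) (hg j)]
    · simp only [Sum.elim_inl, Sum.elim_inr, Function.comp_apply]
      rw [L.B_symm, hval, hvw _ _ (hf j) (hg i), add_zero]
    · simp [hval, ht]
  set c : Fin 4 ⊕ Fin 4 → ℝ := fun i => ρ (z i) with hc
  have hnn := hpd.gram_nonneg τ (Sum.elim (v ∘ f) (w ∘ g)) c
  have hsum : 0 = (∑ i, ∑ j, c i * c j *
      τ (L.B (Sum.elim (v ∘ f) (w ∘ g) i) (Sum.elim (v ∘ f) (w ∘ g) j))) +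
      (∑ i, ∑ j, c (.inr i) * c (.inr j) * t (g i) (g j)) * s := by
    rw [hzero]
    simp only [hsplit, mul_add, Finset.sum_add_distrib]
    congr 1
    simp [hc, Fintype.sum_sum_type, Finset.sum_mul, mul_assoc]
  have hcr : c ∘ Sum.inr = 0 := by
    by_contra h
    have := mul_pos (htpos _ h) hs0
    simp only [Function.comp_apply] at this
    linarith
  have hcr' : ∀ i, c (.inr i) = 0 := fun i => congrFun hcr i
  have hcl0 : c ∘ Sum.inl = 0 := by
    by_contra h
    have := hmpos _ h
    simp [hcr', Fintype.sum_sum_type, ← hvv' _ _ (hf _) (hf _), ← hm _ _ (hf _) (hf _)] at hsum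
    simp only [Function.comp_apply] at this
    linarith
  have hck : c k = 0 := by
    rcases k with k | k
    · exact congrFun hcl0 k
    · exact hcr' k
  refine hk (Subtype.ext (Subtype.ext ?_))
  rw [← hval]
  exact hck
end
end

section
/- Let d be a squarefree positive integer with discriminant Δ_d > (576283867731072000000005)², and let F = ℚ(√d). Then there is no positive definite (possibly non-classic) universal quadratic 𝒪_F-lattice of rank 7. -/
noncomputable section

/-! ### Integral quadratic forms representing `1, …, 31` have rank at least four -/

/-- The diagonal coefficient left after eliminating, from an integral quadratic form, two vectors
of norms `1`, `2` and inner product `a / 2`; the third vector has norm `r` and inner products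
`b / 2`, `c / 2` with them. -/
def schurCoeff (a r b c : ℤ) : ℤ := (8 - a ^ 2) * (4 * r - b ^ 2) - (2 * c - a * b) ^ 2

/-- The ternary form `2 x² ± a x y + y² + δ z²` does not represent `(8 - a²) t`; hence a vector of
norm `t` cannot lie in a ternary lattice with `schurCoeff` in the square class of `δ`. -/
def missesTarget (a δ t : ℕ) : Bool :=
  (List.range 16).all fun z => 8 * t < δ * z * z ||
    (List.range 12).all fun x => 4 * t < x * x ||
      (List.range 16).all fun y => 8 * t < y * y ||
        (2 * x * x + y * y + δ * z * z != (8 - a * a) * t + a * x * y &&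
          2 * x * x + y * y + δ * z * z + a * x * y != (8 - a * a) * t)

/-- Triples `(a, δ, t)` such that a ternary escalator with inner product `a / 2` of the first two
vectors and `schurCoeff` in the square class of `δ` misses the norm `t`. -/
def ternaryTargets : List (ℕ × ℕ × ℕ) :=
  [(0, 2, 14), (0, 1, 7), (0, 6, 10), (0, 7, 21), (0, 13, 13), (0, 15, 10), (0, 21, 7), (0, 22,
   10), (0, 23, 23), (0, 29, 29), (0, 31, 31), (0, 34, 10), (0, 37, 29), (0, 38, 10), (0, 39,
   13), (0, 10, 10), (1, 3, 6), (1, 5, 5), (1, 7, 21), (1, 10, 10), (1, 13, 13), (1, 14, 5), (1,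
   17, 17), (1, 19, 10), (1, 21, 6), (2, 2, 14), (2, 3, 6), (2, 1, 7), (2, 7, 21), (2, 10, 6),
   (2, 11, 22)]

/-- Whether `n` is a value of `schurCoeff` covered by `ternaryTargets`. -/
def isTarget (a : ℕ) : ℕ → Bool
  | 0 => false
  | n + 1 => ternaryTargets.any fun e =>
      e.1 == a && [2, 4, 6, 8, 12].any fun g => n + 1 == e.2.1 * (g * g)

/-- Every ternary escalator with third norm `r` is covered by `ternaryTargets`. -/
def escalatesTernary (a r : ℕ) : Bool :=
  (List.range 9).all fun i => (List.range 13).all fun j =>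
    match schurCoeff a r (i - 4) (j - 6) with
    | .ofNat n => isTarget a n
    | .negSucc _ => true

/-- The norm of the third vector of an escalation. -/
def thirdNorm (a : ℤ) : ℕ := if a = 0 then 5 else 3

set_option maxRecDepth 10000 in
theorem missesTarget_of_mem :
    (ternaryTargets.all fun e => missesTarget e.1 e.2.1 e.2.2) = true := by
  decide +kernel

set_option maxRecDepth 10000 in
theorem escalatesTernary_zero : escalatesTernary 0 5 = true := by
  decide +kernel

set_option maxRecDepth 10000 in
theorem escalatesTernary_one : escalatesTernary 1 3 = true := by
  decide +kernel

set_option maxRecDepth 10000 in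
theorem escalatesTernary_two : escalatesTernary 2 3 = true := by
  decide +kernel

theorem escalatesTernary_thirdNorm {a : ℕ} (ha : a < 3) :
    escalatesTernary a (thirdNorm a) = true := by
  unfold thirdNorm
  interval_cases a
  · rw [if_pos (by norm_num)]; exact escalatesTernary_zero
  · rw [if_neg (by norm_num)]; exact escalatesTernary_one
  · rw [if_neg (by norm_num)]; exact escalatesTernary_two

theorem ternaryTargets_bounds :
    ∀ e ∈ ternaryTargets, 1 ≤ e.2.2 ∧ e.2.2 ≤ 31 := by
  decide

theorem ternaryTargets_squarefree : ∀ e ∈ ternaryTargets, Squarefree e.2.1 := by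
  decide +kernel

theorem int_mem_shift {n m : ℕ} {x : ℤ} (h1 : -m ≤ x) (h2 : x + m < n) :
    ∃ i ∈ List.range n, ((i : ℤ) - m) = x :=
  ⟨(x + m).toNat, by rw [List.mem_range]; omega, by omega⟩

theorem thirdNorm_le (a : ℤ) : thirdNorm a ≤ 5 := by
  unfold thirdNorm; split_ifs <;> norm_num

theorem exists_eq_mul_sq_of_isSquare {δ g : ℕ} {e : ℤ} (hδ : Squarefree δ) (hg : g ≠ 0)
    (h : IsSquare ((δ * g ^ 2 : ℕ) * (4 * e))) : ∃ k : ℕ, e = δ * k ^ 2 := by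
  obtain ⟨m, hm⟩ := h
  have h1 : (2 * (g : ℤ)) ^ 2 ∣ m ^ 2 := ⟨δ * e, by rw [sq m, ← hm]; push_cast; ring⟩
  obtain ⟨n, rfl⟩ := (Int.pow_dvd_pow_iff two_ne_zero).1 h1
  have hg' : (2 * (g : ℤ)) ^ 2 ≠ 0 := by positivity
  have h2 : δ * e = n ^ 2 := by
    refine mul_left_cancel₀ hg' ?_
    push_cast at hm; linarith
  have h3 : (δ : ℤ) ∣ n := by
    rw [← (Int.squarefree_natCast.2 hδ).dvd_pow_iff_dvd two_ne_zero]
    exact ⟨e, h2.symm⟩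
  obtain ⟨k, rfl⟩ := h3
  refine ⟨k.natAbs, mul_left_cancel₀ (Nat.cast_ne_zero.2 hδ.ne_zero) (h2.trans ?_)⟩
  rw [Int.natCast_natAbs, sq_abs]; ring

theorem not_isSquare_of_missesTarget {a δ g t : ℕ} {x y : ℤ} (ht : t ≤ 31) (hδ : Squarefree δ)
    (hg : g ≠ 0) (ha : a ≤ 2) (h : missesTarget a δ t = true) (hx : x ^ 2 ≤ 4 * t)
    (hy : y ^ 2 ≤ 8 * t) : ¬ IsSquare ((δ * g ^ 2 : ℕ) * schurCoeff a t x y) := by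
  intro hsq
  rw [show schurCoeff a t x y = 4 * ((8 - a ^ 2) * t + a * x * y - 2 * x ^ 2 - y ^ 2) by
    unfold schurCoeff; ring] at hsq
  obtain ⟨k, hk⟩ := exists_eq_mul_sq_of_isSquare hδ hg hsq
  have ht' : (t : ℤ) ≤ 31 := by exact_mod_cast ht
  have hδ1 : (1 : ℤ) ≤ δ := by exact_mod_cast hδ.ne_zero.bot_lt
  have hxx : (x.natAbs : ℤ) * x.natAbs = x ^ 2 := by rw [Int.natAbs_mul_self', sq]
  have hyy : (y.natAbs : ℤ) * y.natAbs = y ^ 2 := by rw [Int.natAbs_mul_self', sq]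
  have hkk : (δ : ℤ) * k ^ 2 ≤ 8 * t := by
    have ha2 : (a : ℤ) ^ 2 ≤ 8 := by
      have : (a : ℤ) ≤ 2 := by exact_mod_cast ha
      nlinarith
    nlinarith [sq_nonneg (a * x - 2 * y), mul_nonneg (sub_nonneg.2 ha2) (sq_nonneg x),
      mul_nonneg (sq_nonneg (a : ℤ)) (Nat.cast_nonneg (α := ℤ) t)]
  have hx' : x.natAbs ∈ List.range 12 := by
    rw [List.mem_range]; zify; exact abs_lt_of_sq_lt_sq (by linarith) (by norm_num)
  have hy' : y.natAbs ∈ List.range 16 := by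
    rw [List.mem_range]; zify; exact abs_lt_of_sq_lt_sq (by linarith) (by norm_num)
  have hk' : k ∈ List.range 16 := by
    rw [List.mem_range]; zify
    exact lt_of_pow_lt_pow_left₀ 2 (by norm_num) (by nlinarith [sq_nonneg (k : ℤ)])
  have h := List.all_eq_true.1 h _ hk'
  simp only [Bool.or_eq_true, decide_eq_true_eq] at h
  have h := List.all_eq_true.1 (h.resolve_left (by zify; linarith)) _ hx'
  simp only [Bool.or_eq_true, decide_eq_true_eq] at h
  have h := List.all_eq_true.1 (h.resolve_left (by zify at hxx ⊢; linarith)) _ hy'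
  simp only [Bool.or_eq_true, decide_eq_true_eq] at h
  have h := h.resolve_left (by zify at hyy ⊢; linarith)
  simp only [Bool.and_eq_true, bne_iff_ne, ne_eq] at h
  have ha8 : ((8 - a * a : ℕ) : ℤ) = 8 - a ^ 2 := by
    rw [Nat.cast_sub (by nlinarith)]; push_cast; ring
  zify at h
  rw [ha8] at h
  zify at hxx hyy
  rcases abs_choice (x * y) with hxy | hxy <;> rw [abs_mul] at hxy
  · refine h.1 ?_
    linear_combination -hk + 2 * hxx + hyy - a * hxy
  · refine h.2 ?_
    linear_combination -hk + 2 * hxx + hyy + a * hxy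

theorem exists_target {a b c : ℤ} (ha : a ^ 2 ≤ 8) (hb : b ^ 2 ≤ 4 * thirdNorm a)
    (hc : c ^ 2 ≤ 8 * thirdNorm a) (hα : 0 ≤ schurCoeff a (thirdNorm a) b c) :
    0 < schurCoeff a (thirdNorm a) b c ∧ ∃ t ∈ (Finset.Icc 1 31 : Finset ℕ), ∀ x y : ℤ,
      x ^ 2 ≤ 4 * t → y ^ 2 ≤ 8 * t →
        ¬ IsSquare (schurCoeff a (thirdNorm a) b c * schurCoeff a t x y) := by
  wlog ha0 : 0 ≤ a generalizing a b
  · have hr : thirdNorm (-a) = thirdNorm a := by simp [thirdNorm]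
    have hs : ∀ r x y, schurCoeff (-a) r x y = schurCoeff a r (-x) y := by
      intro r x y; unfold schurCoeff; ring
    obtain ⟨h0, t, ht, h⟩ := this (a := -a) (b := -b) (by simpa) (by simpa [hr]) (by simpa [hr])
      (by simpa [hr, hs]) (by linarith)
    refine ⟨by simpa [hr, hs] using h0, t, ht, fun x y hx hy => ?_⟩
    simpa [hr, hs] using h (-x) y (by simpa) hy
  have hr : (thirdNorm a : ℤ) ≤ 5 := by exact_mod_cast thirdNorm_le a
  lift a to ℕ using ha0
  have hi : a < 3 := by zify; nlinarith
  obtain ⟨j, hj, rfl⟩ := int_mem_shift (n := 9) (m := 4) (x := b)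
    (by push_cast; nlinarith) (by push_cast; nlinarith)
  obtain ⟨k, hk, rfl⟩ := int_mem_shift (n := 13) (m := 6) (x := c)
    (by push_cast; nlinarith) (by push_cast; nlinarith)
  have h := List.all_eq_true.1 (List.all_eq_true.1 (escalatesTernary_thirdNorm hi) j hj) k hk
  obtain ⟨n, hn⟩ := Int.eq_ofNat_of_zero_le hα
  simp only [Nat.cast_ofNat] at hn ⊢
  rw [hn] at h ⊢
  obtain _ | n := n
  · exact absurd h Bool.false_ne_true
  obtain ⟨e, he, h⟩ := List.any_eq_true.1 h
  simp only [Bool.and_eq_true, beq_iff_eq, List.any_eq_true] at h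
  obtain ⟨rfl, g, hgmem, h2⟩ := h
  rw [← sq] at h2
  have hg : g ≠ 0 := by rintro rfl; simp at hgmem
  obtain ⟨e1, e31⟩ := ternaryTargets_bounds e he
  have hm := List.all_eq_true.1 missesTarget_of_mem e he
  refine ⟨by positivity, e.2.2, Finset.mem_Icc.2 ⟨e1, e31⟩, fun x y hx hy => ?_⟩
  rw [h2]
  exact not_isSquare_of_missesTarget e31 (ternaryTargets_squarefree e he) hg
    (Nat.lt_succ_iff.1 hi) hm hx hy

/-- Four-variable form with Gram matrix (of twice the bilinear form) having diagonal
`2, 4, 2 r, 2 t`. -/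
def quaternary {R : Type*} [CommRing R] (a b c r x y z t X₁ X₂ X₃ X₄ : R) : R :=
  2 * X₁ ^ 2 + 4 * X₂ ^ 2 + 2 * r * X₃ ^ 2 + 2 * t * X₄ ^ 2 + 2 * a * X₁ * X₂ + 2 * b * X₁ * X₃
    + 2 * c * X₂ * X₃ + 2 * x * X₁ * X₄ + 2 * y * X₂ * X₄ + 2 * z * X₃ * X₄

theorem quaternary_pos {a b c r x y z t X₁ X₂ X₃ X₄ d α β γ : ℝ} (hd : d = 8 - a ^ 2)
    (hα : α = d * (4 * r - b ^ 2) - (2 * c - a * b) ^ 2)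
    (hβ : β = d * (2 * z - b * x) - (2 * c - a * b) * (2 * y - a * x))
    (hγ : γ = d * (4 * t - x ^ 2) - (2 * y - a * x) ^ 2)
    (d0 : 0 < d) (α0 : 0 < α) (δ0 : 0 < α * γ - β ^ 2)
    (hX : ¬ (X₁ = 0 ∧ X₂ = 0 ∧ X₃ = 0 ∧ X₄ = 0)) :
    0 < quaternary a b c r x y z t X₁ X₂ X₃ X₄ := by
  have key : 2 * d * α * quaternary a b c r x y z t X₁ X₂ X₃ X₄ =
      d * α * (2 * X₁ + a * X₂ + b * X₃ + x * X₄) ^ 2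
      + α * (d * X₂ + (2 * c - a * b) * X₃ + (2 * y - a * x) * X₄) ^ 2
      + (α * X₃ + β * X₄) ^ 2 + (α * γ - β ^ 2) * X₄ ^ 2 := by
    have h : 2 * d * quaternary a b c r x y z t X₁ X₂ X₃ X₄ =
        d * (2 * X₁ + a * X₂ + b * X₃ + x * X₄) ^ 2
        + (d * X₂ + (2 * c - a * b) * X₃ + (2 * y - a * x) * X₄) ^ 2
        + (α * X₃ ^ 2 + 2 * β * X₃ * X₄ + γ * X₄ ^ 2) := by
      rw [hα, hβ, hγ, hd, quaternary]; ring
    linear_combination α * h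
  by_contra hneg
  have hle : 2 * d * α * quaternary a b c r x y z t X₁ X₂ X₃ X₄ ≤ 0 :=
    mul_nonpos_of_nonneg_of_nonpos (by positivity) (not_lt.1 hneg)
  have p1 : 0 ≤ d * α * (2 * X₁ + a * X₂ + b * X₃ + x * X₄) ^ 2 := by positivity
  have p2 : 0 ≤ α * (d * X₂ + (2 * c - a * b) * X₃ + (2 * y - a * x) * X₄) ^ 2 := by positivity
  have p3 : 0 ≤ (α * X₃ + β * X₄) ^ 2 := by positivity
  have p4 : 0 ≤ (α * γ - β ^ 2) * X₄ ^ 2 := by positivity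
  have h4 : X₄ = 0 := by
    have : (α * γ - β ^ 2) * X₄ ^ 2 = 0 := by linarith
    simpa [δ0.ne'] using this
  have h3 : X₃ = 0 := by
    have : (α * X₃ + β * X₄) ^ 2 = 0 := by linarith
    simpa [h4, α0.ne'] using this
  have h2 : X₂ = 0 := by
    have : α * (d * X₂ + (2 * c - a * b) * X₃ + (2 * y - a * x) * X₄) ^ 2 = 0 := by linarith
    simpa [h4, h3, α0.ne', d0.ne'] using this
  have h1 : X₁ = 0 := by
    have : d * α * (2 * X₁ + a * X₂ + b * X₃ + x * X₄) ^ 2 = 0 := by linarith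
    simpa [h4, h3, h2, α0.ne', d0.ne'] using this
  exact hX ⟨h1, h2, h3, h4⟩

theorem abs_le_of_pair {g m n : ℤ} (h1 : 0 ≤ 2 * m + 2 * n + 2 * g)
    (h2 : 0 ≤ 2 * m + 2 * n - 2 * g) : |g| ≤ m + n :=
  abs_le.2 ⟨by linarith, by linarith⟩

theorem abs_mul_le_mul {x y A B : ℤ} (hx : |x| ≤ A) (hy : |y| ≤ B) : |x * y| ≤ A * B := by
  rw [abs_mul]
  exact mul_le_mul hx hy (abs_nonneg _) ((abs_nonneg _).trans hx)

theorem abs_sub_le_add {x y A B : ℤ} (hx : |x| ≤ A) (hy : |y| ≤ B) : |x - y| ≤ A + B :=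
  (abs_sub x y).trans (add_le_add hx hy)

/-- An integral quadratic form, given by its Gram matrix `g` on vectors of norms `1, 2, …`, which is
nonnegative on short combinations is positive definite on the span of four of the vectors. -/
theorem exists_four_posDef (g : ℕ → ℕ → ℤ) (symm : ∀ s t, g s t = g t s)
    (diag : ∀ t ∈ Finset.Icc 1 31, g t t = 2 * t)
    (nonneg : ∀ t : Fin 4 → ℕ, (∀ i, t i ∈ Finset.Icc 1 31) → ∀ x : Fin 4 → ℤ,
      (∀ i, |x i| ≤ 10 ^ 9) → 0 ≤ ∑ i, ∑ j, x i * x j * g (t i) (t j)) :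
    ∃ t : Fin 4 → ℕ, (∀ i, t i ∈ Finset.Icc 1 31) ∧ ∀ y : Fin 4 → ℝ, y ≠ 0 →
      0 < ∑ i, ∑ j, y i * y j * g (t i) (t j) := by
  have pair : ∀ s ∈ Finset.Icc 1 31, ∀ t ∈ Finset.Icc 1 31, ∀ p q : ℤ, |p| ≤ 10 ^ 9 →
      |q| ≤ 10 ^ 9 → 0 ≤ 2 * s * p ^ 2 + 2 * t * q ^ 2 + 2 * p * q * g s t := by
    intro s hs t ht p q hp hq
    have := nonneg ![s, t, s, s] (by simp [Fin.forall_fin_succ] at *; omega) ![p, q, 0, 0]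
      (by simpa [Fin.forall_fin_succ] using And.intro hp hq)
    simp [Fin.sum_univ_four, diag s hs, diag t ht, symm t s] at this
    linarith
  have bound : ∀ s ∈ Finset.Icc 1 31, ∀ t ∈ Finset.Icc 1 31, |g s t| ≤ s + t := by
    intro s hs t ht
    have h1 := pair s hs t ht 1 1 (by norm_num) (by norm_num)
    have h2 := pair s hs t ht 1 (-1) (by norm_num) (by norm_num)
    exact abs_le_of_pair (by linarith) (by linarith)
  have mem1 : 1 ∈ Finset.Icc 1 31 := by decide
  have mem2 : 2 ∈ Finset.Icc 1 31 := by decide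
  have cs : ∀ s ∈ Finset.Icc 1 31, ∀ t ∈ Finset.Icc 1 31, g s t ^ 2 ≤ 4 * s * t := by
    intro s hs t ht
    have hb := bound s hs t ht
    have hs' := Finset.mem_Icc.1 hs
    have ht' := Finset.mem_Icc.1 ht
    have h := pair s hs t ht (-g s t) (2 * s) (by rw [abs_neg]; omega) (by rw [abs_le]; omega)
    have hs0 : (0 : ℤ) < s := by exact_mod_cast hs'.1
    have : 0 ≤ (2 * s : ℤ) * (4 * s * t - g s t ^ 2) := by nlinarith
    have := nonneg_of_mul_nonneg_right this (by positivity)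
    linarith
  obtain ⟨a, ha⟩ : ∃ a, a = g 1 2 := ⟨_, rfl⟩
  obtain ⟨r, hr⟩ : ∃ r, r = thirdNorm a := ⟨_, rfl⟩
  have memr : r ∈ Finset.Icc 1 31 := by
    rw [hr, Finset.mem_Icc]; unfold thirdNorm; split_ifs <;> norm_num
  obtain ⟨b, hb⟩ : ∃ b, b = g 1 r := ⟨_, rfl⟩
  obtain ⟨c, hc⟩ : ∃ c, c = g 2 r := ⟨_, rfl⟩
  have hr5 : r ≤ 5 := hr ▸ thirdNorm_le a
  have quat : ∀ t ∈ Finset.Icc 1 31, ∀ p q u v : ℤ, |p| ≤ 10 ^ 9 → |q| ≤ 10 ^ 9 →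
      |u| ≤ 10 ^ 9 → |v| ≤ 10 ^ 9 →
      0 ≤ quaternary a b c r (g 1 t) (g 2 t) (g r t) t p q u v := by
    intro t ht p q u v hp hq hu hv
    have := nonneg ![1, 2, r, t] (by simp [Fin.forall_fin_succ] at *; omega) ![p, q, u, v]
      (by simpa [Fin.forall_fin_succ] using ⟨hp, hq, hu, hv⟩)
    simp [Fin.sum_univ_four, diag t ht, diag r memr, diag 1 mem1, diag 2 mem2, symm t, symm r 1,
      symm r 2, symm 2 1] at this
    rw [quaternary, ha, hb, hc]
    linarith
  have ha2 : a ^ 2 ≤ 8 := by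
    have := cs 1 mem1 2 mem2; rw [← ha] at this; push_cast at this; linarith
  have ha3 : |a| ≤ 3 := by simpa [ha] using bound 1 mem1 2 mem2
  have hb6 : |b| ≤ 6 := by
    have := bound 1 mem1 r memr; rw [← hb] at this; push_cast at this; omega
  have hc7 : |c| ≤ 7 := by
    have := bound 2 mem2 r memr; rw [← hc] at this; push_cast at this; omega
  have d0 : 0 < 8 - a ^ 2 := by
    rcases ha2.lt_or_eq with h | h
    · linarith
    · have : a < 3 := by nlinarith
      have : -3 < a := by nlinarith
      interval_cases a <;> omega
  have d8 : |8 - a ^ 2| ≤ 8 := by rw [abs_of_pos d0]; nlinarith [sq_nonneg a]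
  have e20 : |2 * c - a * b| ≤ 2 * 7 + 3 * 6 :=
    abs_sub_le_add (abs_mul_le_mul (by norm_num) hc7) (abs_mul_le_mul ha3 hb6)
  -- after eliminating the first two vectors, the form is nonnegative in the last two
  have elim : ∀ t ∈ Finset.Icc 1 31, ∀ p q : ℤ, |p| ≤ 10 ^ 4 → |q| ≤ 10 ^ 4 →
      0 ≤ schurCoeff a r b c * p ^ 2
        + 2 * ((8 - a ^ 2) * (2 * g r t - b * g 1 t) - (2 * c - a * b) * (2 * g 2 t - a * g 1 t))
          * p * q
        + schurCoeff a t (g 1 t) (g 2 t) * q ^ 2 := by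
    intro t ht p q hp hq
    have ht' := Finset.mem_Icc.1 ht
    have hx : |g 1 t| ≤ 32 := by
      have := bound 1 mem1 t ht; push_cast at this; omega
    have hy : |g 2 t| ≤ 33 := by
      have := bound 2 mem2 t ht; push_cast at this; omega
    have f20 : |2 * g 2 t - a * g 1 t| ≤ 2 * 33 + 3 * 32 :=
      abs_sub_le_add (abs_mul_le_mul (by norm_num) hy) (abs_mul_le_mul ha3 hx)
    obtain ⟨w, hw⟩ : ∃ w, w = (2 * c - a * b) * p + (2 * g 2 t - a * g 1 t) * q := ⟨_, rfl⟩
    have hw' : |w| ≤ (2 * 7 + 3 * 6) * 10 ^ 4 + (2 * 33 + 3 * 32) * 10 ^ 4 := by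
      rw [hw]
      exact (abs_add_le _ _).trans (add_le_add (abs_mul_le_mul e20 hp) (abs_mul_le_mul f20 hq))
    have hdp := abs_mul_le_mul d8 hp
    have hdq := abs_mul_le_mul d8 hq
    have h1 : |a * w - b * ((8 - a ^ 2) * p) - g 1 t * ((8 - a ^ 2) * q)| ≤ _ :=
      abs_sub_le_add (abs_sub_le_add (abs_mul_le_mul ha3 hw') (abs_mul_le_mul hb6 hdp))
        (abs_mul_le_mul hx hdq)
    have h := quat t ht (a * w - b * ((8 - a ^ 2) * p) - g 1 t * ((8 - a ^ 2) * q)) (-2 * w)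
      (2 * ((8 - a ^ 2) * p)) (2 * ((8 - a ^ 2) * q)) (h1.trans (by norm_num))
      ((abs_mul_le_mul (A := 2) (by norm_num) hw').trans (by norm_num))
      ((abs_mul_le_mul (A := 2) (by norm_num) hdp).trans (by norm_num))
      ((abs_mul_le_mul (A := 2) (by norm_num) hdq).trans (by norm_num))
    refine nonneg_of_mul_nonneg_right (a := 2 * (8 - a ^ 2)) (h.trans_eq ?_) (by linarith)
    rw [hw]; unfold quaternary schurCoeff; ring
  have α0 : 0 ≤ schurCoeff a r b c := by
    simpa using elim 1 mem1 1 0 (by norm_num) (by norm_num)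
  obtain ⟨αpos, t, memt, hsq⟩ := exists_target (a := a) (b := b) (c := c) ha2
    (by have := cs 1 mem1 r memr; rw [← hb, hr] at this; push_cast at this; linarith)
    (by have := cs 2 mem2 r memr; rw [← hc, hr] at this; push_cast at this; linarith)
    (hr ▸ α0)
  rw [← hr] at αpos hsq
  obtain ⟨x, hx⟩ : ∃ x, x = g 1 t := ⟨_, rfl⟩
  obtain ⟨y, hy⟩ : ∃ y, y = g 2 t := ⟨_, rfl⟩
  obtain ⟨z, hz⟩ : ∃ z, z = g r t := ⟨_, rfl⟩
  have helim := elim t memt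
  rw [← hx, ← hy, ← hz] at helim
  obtain ⟨γ, hγ⟩ : ∃ γ, γ = schurCoeff a t x y := ⟨_, rfl⟩
  obtain ⟨α, hα⟩ : ∃ α, α = schurCoeff a r b c := ⟨_, rfl⟩
  obtain ⟨β, hβ⟩ : ∃ β, β = (8 - a ^ 2) * (2 * z - b * x) - (2 * c - a * b) * (2 * y - a * x) :=
    ⟨_, rfl⟩
  rw [← hβ, ← hγ, ← hα] at helim
  rw [← hα] at αpos
  have hns := hsq x y
    (by have := cs 1 mem1 t memt; rw [← hx] at this; push_cast at this; linarith)
    (by have := cs 2 mem2 t memt; rw [← hy] at this; push_cast at this; linarith)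
  rw [← hα, ← hγ] at hns
  have hne : α * γ - β ^ 2 ≠ 0 := fun h => hns ⟨β, by linarith [sq β]⟩
  have ht' := Finset.mem_Icc.1 memt
  have hx32 : |x| ≤ 32 := by
    have := bound 1 mem1 t memt; rw [← hx] at this; push_cast at this; omega
  have hy33 : |y| ≤ 33 := by
    have := bound 2 mem2 t memt; rw [← hy] at this; push_cast at this; omega
  have hz36 : |z| ≤ 36 := by
    have := bound r memr t memt; rw [← hz] at this; omega
  have βle : |β| ≤ _ := hβ ▸ abs_sub_le_add
    (abs_mul_le_mul d8 (abs_sub_le_add (abs_mul_le_mul (A := 2) (by norm_num) hz36)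
      (abs_mul_le_mul hb6 hx32)))
    (abs_mul_le_mul e20 (abs_sub_le_add (abs_mul_le_mul (A := 2) (by norm_num) hy33)
      (abs_mul_le_mul ha3 hx32)))
  have αle : |α| ≤ 160 := by
    rw [abs_of_pos αpos, hα]
    unfold schurCoeff
    have h1 : (r : ℤ) ≤ 5 := by exact_mod_cast hr5
    nlinarith [sq_nonneg (2 * c - a * b), sq_nonneg a, sq_nonneg b, mul_nonneg d0.le (sq_nonneg b)]
  have δ0 : 0 ≤ α * γ - β ^ 2 := by
    have h := helim (-β) α (by rw [abs_neg]; exact βle.trans (by norm_num))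
      (αle.trans (by norm_num))
    refine nonneg_of_mul_nonneg_right (a := α) (h.trans_eq (by ring)) αpos
  refine ⟨![1, 2, r, t], by simp [Fin.forall_fin_succ] at *; omega, fun Y hY => ?_⟩
  have h := quaternary_pos (a := a) (b := b) (c := c) (r := r) (x := x) (y := y) (z := z) (t := t)
    (X₁ := Y 0) (X₂ := Y 1) (X₃ := Y 2) (X₄ := Y 3) (d := (8 - a ^ 2 : ℤ)) (α := α) (β := β)
    (γ := γ) (by push_cast; ring) (by rw [hα, schurCoeff]; push_cast; ring)
    (by rw [hβ]; push_cast; ring) (by rw [hγ, schurCoeff]; push_cast; ring)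
    (by exact_mod_cast d0) (by exact_mod_cast αpos)
    (by exact_mod_cast lt_of_le_of_ne δ0 hne.symm)
    (fun h => hY (by ext i; fin_cases i <;> simp [h]))
  refine h.trans_eq ?_
  simp [Fin.sum_univ_four, diag t memt, diag r memr, diag 1 mem1, diag 2 mem2, symm t, symm r 1,
      symm r 2, symm 2 1, ← ha, ← hb, ← hc, ← hx, ← hy, ← hz, quaternary]
  ring

/-! ### The two real embeddings of `ℚ(√d)` -/

section Embeddings

variable {d : ℕ}

theorem exists_eq_add_mul_sqrt (x : Fd d) : ∃ p q : ℚ, (x : ℝ) = p + q * √d := by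
  have hs : √(d : ℝ) * √d = d := Real.mul_self_sqrt d.cast_nonneg
  obtain ⟨x, hx⟩ := x
  change ∃ p q : ℚ, x = p + q * √d
  refine IntermediateField.adjoin_induction ℚ (p := fun x _ => ∃ p q : ℚ, x = p + q * √d)
    ?_ ?_ ?_ ?_ ?_ hx
  · rintro x rfl
    exact ⟨0, 1, by simp⟩
  · exact fun x => ⟨x, 0, by simp⟩
  · rintro _ _ _ _ ⟨p, q, rfl⟩ ⟨p', q', rfl⟩
    exact ⟨p + p', q + q', by push_cast; ring⟩
  · rintro _ _ ⟨p, q, rfl⟩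
    by_cases h : (p : ℝ) + q * √d = 0
    · exact ⟨0, 0, by simp [h]⟩
    by_cases h' : (p : ℝ) - q * √d = 0
    · exact ⟨(2 * p)⁻¹, 0, by
        rw [show (p : ℝ) + q * √d = 2 * p by linarith]; push_cast; ring⟩
    · have hn : (p : ℝ) ^ 2 - d * q ^ 2 ≠ 0 := by
        rw [show (p : ℝ) ^ 2 - d * q ^ 2 = (p + q * √d) * (p - q * √d) by
          linear_combination q ^ 2 * hs]
        exact mul_ne_zero h h'
      refine ⟨p / (p ^ 2 - d * q ^ 2), -q / (p ^ 2 - d * q ^ 2), ?_⟩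
      rw [inv_eq_of_mul_eq_one_right]
      push_cast
      rw [show (p / (p ^ 2 - d * q ^ 2) + -q / (p ^ 2 - d * q ^ 2) * √d : ℝ) =
        (p - q * √d) / (p ^ 2 - d * q ^ 2) by ring, ← mul_div_assoc, div_eq_one_iff_eq hn]
      linear_combination -(q : ℝ) ^ 2 * hs
  · rintro _ _ _ _ ⟨p, q, rfl⟩ ⟨p', q', rfl⟩
    refine ⟨p * p' + d * q * q', p * q' + q * p', ?_⟩
    push_cast
    linear_combination (q * q' : ℝ) * hs

/-- The embedding of `ℚ(√d)` into `ℝ` with `√d > 0`. -/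
def realEmbedding (d : ℕ) : Fd d →ₐ[ℚ] ℝ := (Fd d).val

theorem realEmbedding_apply (x : Fd d) : realEmbedding d x = x := rfl

theorem sqrt_mem_Fd : √(d : ℝ) ∈ Fd d := IntermediateField.subset_adjoin _ _ rfl

theorem algHom_eq_of_eq_add_mul_sqrt (φ : Fd d →ₐ[ℚ] ℝ) {x : Fd d} {p q : ℚ}
    (h : (x : ℝ) = p + q * √d) : φ x = p + q * φ ⟨√d, sqrt_mem_Fd⟩ := by
  have : x = algebraMap ℚ (Fd d) p + algebraMap ℚ (Fd d) q * ⟨√d, sqrt_mem_Fd⟩ :=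
    Subtype.ext (by simpa using h)
  rw [this, map_add, map_mul, AlgHom.commutes, AlgHom.commutes]
  simp

/-- A homomorphism `ℚ(√d) → ℝ` is a conjugation if it maps `√d` to `-√d`. -/
def IsConjugation (σ : Fd d →ₐ[ℚ] ℝ) : Prop := σ ⟨√d, sqrt_mem_Fd⟩ = -√d

theorem IsConjugation.apply {σ : Fd d →ₐ[ℚ] ℝ} (hσ : IsConjugation σ) {x : Fd d} {p q : ℚ}
    (h : (x : ℝ) = p + q * √d) : σ x = p - q * √d := by
  rw [algHom_eq_of_eq_add_mul_sqrt σ h, hσ]; ring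

theorem irrational_sqrt_of_squarefree (hd : Squarefree d) (h1 : 1 < d) : Irrational √(d : ℝ) := by
  rw [irrational_sqrt_natCast_iff]
  rintro ⟨m, rfl⟩
  have := Nat.isUnit_iff.1 (hd m dvd_rfl)
  subst this
  exact lt_irrefl _ h1

theorem exists_isConjugation (hirr : Irrational √(d : ℝ)) :
    ∃ σ : Fd d →ₐ[ℚ] ℝ, IsConjugation σ := by
  open Polynomial in
  have hs : √(d : ℝ) ^ 2 = d := Real.sq_sqrt d.cast_nonneg
  have hmonic : (X ^ 2 - C (d : ℚ)).Monic := monic_X_pow_sub_C _ two_ne_zero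
  have hroot : aeval √(d : ℝ) (X ^ 2 - C (d : ℚ)) = 0 := by simp [hs]
  have hint : IsIntegral ℚ √(d : ℝ) := ⟨_, hmonic, by rwa [← aeval_def]⟩
  have hirred : Irreducible (X ^ 2 - C (d : ℚ)) := by
    refine X_pow_sub_C_irreducible_of_prime Nat.prime_two fun b hb => hirr ⟨|b|, ?_⟩
    have : (b : ℝ) ^ 2 = d := by exact_mod_cast hb
    rw [← this, Real.sqrt_sq_eq_abs, Rat.cast_abs]
  have hmin := minpoly.eq_of_irreducible_of_monic hirred hroot hmonic
  have hmem : -√(d : ℝ) ∈ (minpoly ℚ √(d : ℝ)).aroots ℝ := by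
    rw [← hmin, mem_aroots]
    exact ⟨hmonic.ne_zero, by simp [hs]⟩
  exact ⟨(IntermediateField.algHomAdjoinIntegralEquiv ℚ hint).symm ⟨_, hmem⟩,
    IntermediateField.algHomAdjoinIntegralEquiv_symm_apply_gen ℚ hint ⟨_, hmem⟩⟩

theorem algHom_eq_coe_or_eq {σ : Fd d →ₐ[ℚ] ℝ} (hσ : IsConjugation σ) (φ : Fd d →ₐ[ℚ] ℝ) :
    (∀ x, φ x = x) ∨ φ = σ := by
  have hs : (⟨√d, sqrt_mem_Fd⟩ : Fd d) * ⟨√d, sqrt_mem_Fd⟩ = (d : Fd d) :=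
    Subtype.ext (by simp)
  have h : φ ⟨√d, sqrt_mem_Fd⟩ * φ ⟨√d, sqrt_mem_Fd⟩ = √d * √d := by
    rw [← map_mul, hs, map_natCast, Real.mul_self_sqrt d.cast_nonneg]
  rcases mul_self_eq_mul_self_iff.1 h with h | h
  · left
    intro x
    obtain ⟨p, q, hx⟩ := exists_eq_add_mul_sqrt x
    rw [algHom_eq_of_eq_add_mul_sqrt φ hx, h, hx]
  · right
    ext x
    obtain ⟨p, q, hx⟩ := exists_eq_add_mul_sqrt x
    rw [algHom_eq_of_eq_add_mul_sqrt φ hx, h, hσ.apply hx]; ring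

theorem exists_int_of_isIntegral_ratCast {q : ℚ} (h : IsIntegral ℤ (q : ℝ)) : ∃ n : ℤ, q = n := by
  have h' : IsIntegral ℤ q := by
    rw [← isIntegral_algebraMap_iff (algebraMap ℚ ℝ).injective]; simpa using h
  obtain ⟨n, hn⟩ := IsIntegrallyClosed.isIntegral_iff.1 h'
  exact ⟨n, by simpa using hn.symm⟩

theorem sqrt_Delta : √(Delta d : ℝ) = if d % 4 = 1 then √(d : ℝ) else 2 * √d := by
  unfold Delta
  split_ifs
  · rfl
  · rw [Nat.cast_mul, Real.sqrt_mul (by norm_num),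
      show ((4 : ℕ) : ℝ) = 2 ^ 2 by norm_num, Real.sqrt_sq (by norm_num)]

theorem exists_int_add_conj {σ : Fd d →ₐ[ℚ] ℝ} (hσ : IsConjugation σ) (x : Od d) :
    ∃ n : ℤ, ((x : Fd d) : ℝ) + σ x = n := by
  obtain ⟨p, q, hx⟩ := exists_eq_add_mul_sqrt (x : Fd d)
  have h : ((x : Fd d) : ℝ) + σ x = (2 * p : ℚ) := by
    rw [hσ.apply hx, hx]; push_cast; ring
  have i1 : IsIntegral ℤ ((x : Fd d) : ℝ) := x.isIntegral_coe.map (realEmbedding d)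
  have i2 : IsIntegral ℤ (σ x) := x.isIntegral_coe.map σ
  obtain ⟨n, hn⟩ := exists_int_of_isIntegral_ratCast (h ▸ i1.add i2)
  exact ⟨n, by rw [h, hn]; simp⟩

theorem exists_int_sub_conj (hd : Squarefree d) {σ : Fd d →ₐ[ℚ] ℝ} (hσ : IsConjugation σ)
    (x : Od d) : ∃ n : ℤ, ((x : Fd d) : ℝ) - σ x = n * √(Delta d : ℝ) := by
  obtain ⟨p, q, hx⟩ := exists_eq_add_mul_sqrt (x : Fd d)
  have hx' := hσ.apply hx
  have hs : √(d : ℝ) * √d = d := Real.mul_self_sqrt d.cast_nonneg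
  obtain ⟨T, hT⟩ := exists_int_add_conj hσ x
  have i1 : IsIntegral ℤ ((x : Fd d) : ℝ) := x.isIntegral_coe.map (realEmbedding d)
  have i2 : IsIntegral ℤ (σ x) := x.isIntegral_coe.map σ
  have hN' : ((x : Fd d) : ℝ) * σ x = (p ^ 2 - d * q ^ 2 : ℚ) := by
    rw [hx', hx]; push_cast; linear_combination -(q : ℝ) ^ 2 * hs
  obtain ⟨N, hN⟩ := exists_int_of_isIntegral_ratCast (hN' ▸ i1.mul i2)
  have hT2 : 2 * p = T := by
    rw [hx', hx] at hT
    have : ((2 * p : ℚ) : ℝ) = (T : ℚ) := by push_cast; linarith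
    exact_mod_cast this
  have hq : d * (2 * q) ^ 2 = T ^ 2 - 4 * N := by rw [← hT2, ← hN]; ring
  have hd0 : (d : ℚ) ≠ 0 := Nat.cast_ne_zero.2 hd.ne_zero
  obtain ⟨c, hc⟩ : ∃ c : ℤ, d * (2 * q) = c := by
    have : IsIntegral ℤ (d * (2 * q)) := by
      refine IsIntegral.of_pow two_pos ?_
      rw [show (d * (2 * q)) ^ 2 = ((d * (T ^ 2 - 4 * N) : ℤ) : ℚ) by
        push_cast; rw [← hq]; ring]
      exact isIntegral_algebraMap (R := ℤ) (A := ℚ)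
    obtain ⟨n, hn⟩ := IsIntegrallyClosed.isIntegral_iff.1 this
    exact ⟨n, by simpa using hn.symm⟩
  have hdc : (d : ℤ) ∣ c := by
    rw [← (Int.squarefree_natCast.2 hd).dvd_pow_iff_dvd two_ne_zero]
    refine ⟨T ^ 2 - 4 * N, ?_⟩
    have : (c : ℚ) ^ 2 = d * (T ^ 2 - 4 * N) := by rw [← hc, ← hq]; ring
    exact_mod_cast this
  obtain ⟨k, rfl⟩ := hdc
  have hk : 2 * q = k := mul_left_cancel₀ hd0 (by simpa using hc)
  have hdk : (d : ℤ) * k ^ 2 = T ^ 2 - 4 * N := by rw [hk] at hq; exact_mod_cast hq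
  have hk' : 2 * (q : ℝ) = k := by exact_mod_cast hk
  rw [sqrt_Delta]
  split_ifs with h4
  · exact ⟨k, by rw [hx, hx', ← hk']; ring⟩
  · obtain ⟨m, rfl | rfl⟩ := Int.even_or_odd' k
    · refine ⟨m, ?_⟩
      rw [hx, hx']; push_cast at hk'; linear_combination √(d : ℝ) * hk'
    · exfalso
      have h0 : d % 4 ≠ 0 := fun h => by
        have := Nat.isUnit_iff.1 (hd 2 (Nat.dvd_of_mod_eq_zero h))
        omega
      have e : (d : ℤ) = T ^ 2 - 4 * (N + d * (m ^ 2 + m)) := by linear_combination hdk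
      obtain ⟨u, rfl | rfl⟩ := Int.even_or_odd' T
      · ring_nf at e; omega
      · ring_nf at e; omega

theorem exists_int_of_conj_eq_s2 {σ : Fd d →ₐ[ℚ] ℝ} (hσ : IsConjugation σ)
    {x : Od d} (h : ((x : Fd d) : ℝ) = σ x) :
    ∃ n : ℤ, ((x : Fd d) : ℝ) = n := by
  obtain ⟨p, q, hx⟩ := exists_eq_add_mul_sqrt (x : Fd d)
  have hq : (q : ℝ) * √d = 0 := by rw [hσ.apply hx, hx] at h; linarith
  have i1 : IsIntegral ℤ ((x : Fd d) : ℝ) := x.isIntegral_coe.map (realEmbedding d)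
  rw [hq, add_zero] at hx
  obtain ⟨n, hn⟩ := exists_int_of_isIntegral_ratCast (hx ▸ i1)
  exact ⟨n, by rw [hx, hn]; simp⟩

theorem totPos_iff {σ : Fd d →ₐ[ℚ] ℝ} (hσ : IsConjugation σ) {x : Fd d} :
    TotPos x ↔ 0 < (x : ℝ) ∧ 0 < σ x := by
  refine ⟨fun h => ⟨h (realEmbedding d), h σ⟩, fun h φ => ?_⟩
  obtain h' | rfl := algHom_eq_coe_or_eq hσ φ
  · exact h' x ▸ h.1
  · exact h.2

theorem exists_sub_conj_eq_sqrt_Delta {σ : Fd d →ₐ[ℚ] ℝ} (hσ : IsConjugation σ) :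
    ∃ x : Od d, ((x : Fd d) : ℝ) - σ x = √(Delta d : ℝ) := by
  have hs : √(d : ℝ) * √d = d := Real.mul_self_sqrt d.cast_nonneg
  have key : ∀ x : ℝ, ∀ hx : x ∈ Fd d, IsIntegral ℤ x →
      ∃ y : Od d, (y : Fd d) = ⟨x, hx⟩ := fun x hx hi =>
    ⟨⟨⟨x, hx⟩,
      (isIntegral_algHom_iff ((Fd d).val.restrictScalars ℤ) Subtype.val_injective).1 hi⟩, rfl⟩
  rw [sqrt_Delta]
  split_ifs with h4
  · have hmem : (1 + √(d : ℝ)) / 2 ∈ Fd d :=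
      div_mem (add_mem (one_mem _) sqrt_mem_Fd) (ofNat_mem _ 2)
    have hi : IsIntegral ℤ ((1 + √(d : ℝ)) / 2) := by
      open Polynomial in
      refine ⟨X ^ 2 - X - C (d / 4 : ℤ), by monicity!, ?_⟩
      have h : (d : ℝ) = 4 * ((d / 4 : ℕ) : ℝ) + 1 := by
        have : d = 4 * (d / 4) + 1 := by omega
        exact_mod_cast this
      simp only [eval₂_sub, eval₂_pow, eval₂_X, eval₂_C]
      rw [show ((d : ℤ) / 4) = ((d / 4 : ℕ) : ℤ) by norm_num]
      simp only [eq_intCast, Int.cast_natCast]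
      linear_combination hs / 4 + h / 4
    obtain ⟨y, hy⟩ := key _ hmem hi
    have hv : ((y : Fd d) : ℝ) = ((1 / 2 : ℚ) : ℝ) + ((1 / 2 : ℚ) : ℝ) * √d := by
      rw [hy]; push_cast; ring
    exact ⟨y, by rw [hσ.apply hv, hv]; push_cast; ring⟩
  · have hi : IsIntegral ℤ √(d : ℝ) :=
      IsIntegral.of_pow two_pos
        (by rw [sq, hs]; exact isIntegral_algebraMap (R := ℤ) (A := ℝ) (x := d))
    obtain ⟨y, hy⟩ := key _ sqrt_mem_Fd hi
    have hv : ((y : Fd d) : ℝ) = ((0 : ℚ) : ℝ) + ((1 : ℚ) : ℝ) * √d := by rw [hy]; simp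
    exact ⟨y, by rw [hσ.apply hv, hv]; push_cast; ring⟩

theorem exists_totPos_sub_conj_eq {σ : Fd d →ₐ[ℚ] ℝ} (hσ : IsConjugation σ) (t : ℕ) :
    ∃ x : Od d, TotPos (x : Fd d) ∧ ((x : Fd d) : ℝ) - σ x = t * √(Delta d : ℝ) ∧ σ x ≤ 1 := by
  obtain ⟨β, hβ⟩ := exists_sub_conj_eq_sqrt_Delta hσ
  obtain ⟨x, hx⟩ : ∃ x : Od d, x = t * β + ((⌊-(t * σ β)⌋ + 1 : ℤ) : Od d) := ⟨_, rfl⟩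
  have h1 : ((x : Fd d) : ℝ) = t * (β : Fd d) + (⌊-(t * σ β)⌋ + 1) := by
    rw [hx]; simp
  have h2 : σ x = t * σ β + (⌊-(t * σ β)⌋ + 1) := by
    rw [hx]; simp
  have h3 : ((x : Fd d) : ℝ) - σ x = t * √(Delta d : ℝ) := by rw [h1, h2, ← hβ]; ring
  have h4 : 0 < σ x := by rw [h2]; linarith [Int.lt_floor_add_one (-(t * σ β))]
  refine ⟨x, (totPos_iff hσ).2 ⟨?_, h4⟩, h3, ?_⟩
  · have : (0 : ℝ) ≤ t * √(Delta d : ℝ) := by positivity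
    linarith
  · rw [h2]; linarith [Int.floor_le (-(t * σ β))]

theorem totPos_natCast {t : ℕ} (ht : 0 < t) : TotPos ((t : Od d) : Fd d) := by
  intro φ
  simpa using ht

end Embeddings

/-! ### Universal lattices over real quadratic fields of large discriminant -/

namespace QuadLattice

variable {d : ℕ} (L : QuadLattice d)

/-- The bilinear form of a quadratic lattice as a bilinear map. -/
def bilin : L.carrier →ₗ[Od d] L.carrier →ₗ[Od d] Fd d :=
  LinearMap.mk₂ (Od d) L.B L.B_add_left
    (fun a x y => by rw [L.B_smul_left, Algebra.smul_def])
    (fun x y z => by rw [L.B_symm x, L.B_add_left, L.B_symm y, L.B_symm z])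
    (fun a x y => by rw [L.B_symm x, L.B_smul_left, L.B_symm y, Algebra.smul_def])

theorem bilin_apply (x y : L.carrier) : L.bilin x y = L.B x y := rfl

theorem coe_Q (x : L.carrier) : (L.Q x : Fd d) = L.bilin x x := (L.B_self x).symm

theorem map_Q_sum {ι : Type*} [Fintype ι] (φ : Fd d →ₐ[ℚ] ℝ) (a : ι → Od d)
    (u : ι → L.carrier) :
    φ (L.Q (∑ i, a i • u i)) = ∑ i, ∑ j, φ (a i) * φ (a j) * φ (L.B (u i) (u j)) := by
  simp only [coe_Q, map_sum, LinearMap.sum_apply, map_smul, LinearMap.smul_apply,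
    Algebra.smul_def, map_mul, bilin_apply]
  simp only [Finset.mul_sum, ← mul_assoc]
  exact Finset.sum_congr rfl fun i _ => Finset.sum_congr rfl fun j _ => by
    rw [L.B_symm]

theorem exists_two_mul_B_eq (x y : L.carrier) : ∃ b : Od d, (b : Fd d) = L.B x y + L.B x y :=
  ⟨L.Q (x + y) - L.Q x - L.Q y, by rw [← two_mul, L.B_def]; simp⟩

variable {L}

theorem PosDef.map_Q_nonneg (hpd : L.PosDef) (φ : Fd d →ₐ[ℚ] ℝ) (x : L.carrier) :
    0 ≤ φ (L.Q x) := by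
  by_cases hx : x = 0
  · simp [coe_Q, hx]
  · exact (hpd x hx φ).le

theorem PosDef.map_Q_add_le (hpd : L.PosDef) (φ : Fd d →ₐ[ℚ] ℝ) (x y : L.carrier) :
    φ (L.Q (x + y)) ≤ 2 * φ (L.Q x) + 2 * φ (L.Q y) := by
  have h := hpd.map_Q_nonneg φ (x - y)
  simp only [coe_Q, map_add, map_sub, LinearMap.add_apply, LinearMap.sub_apply] at h ⊢
  linarith

/-- `g x y` is twice the coefficient of `√Δ` in `B x y`, that is, `B x y` minus its conjugate is
`g x y / 2 * √Δ`. -/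
def IsIrrationalPart (L : QuadLattice d) (σ : Fd d →ₐ[ℚ] ℝ)
    (g : L.carrier → L.carrier → ℤ) : Prop :=
  ∀ x y, 2 * (L.B x y : ℝ) - 2 * σ (L.B x y) = g x y * √(Delta d : ℝ)

theorem exists_isIrrationalPart (L : QuadLattice d) (hd : Squarefree d) {σ : Fd d →ₐ[ℚ] ℝ}
    (hσ : IsConjugation σ) : ∃ g, L.IsIrrationalPart σ g := by
  have h : ∀ x y, ∃ n : ℤ, 2 * (L.B x y : ℝ) - 2 * σ (L.B x y) = n * √(Delta d : ℝ) := by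
    intro x y
    obtain ⟨b, hb⟩ := L.exists_two_mul_B_eq x y
    obtain ⟨n, hn⟩ := exists_int_sub_conj hd hσ b
    exact ⟨n, by rw [← hn, hb, map_add]; push_cast; ring⟩
  choose g hg using h
  exact ⟨g, hg⟩

namespace IsIrrationalPart

variable {σ : Fd d →ₐ[ℚ] ℝ} {g : L.carrier → L.carrier → ℤ}

theorem symm (hg : L.IsIrrationalPart σ g) (hΔ : 0 < √(Delta d : ℝ)) (x y : L.carrier) :
    g x y = g y x := by
  have h := hg x y
  rw [L.B_symm, hg] at h
  exact_mod_cast (mul_right_cancel₀ hΔ.ne' h).symm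

theorem self_eq (hg : L.IsIrrationalPart σ g) (hΔ : 0 < √(Delta d : ℝ)) {x : L.carrier} {t : ℤ}
    (ht : ((L.Q x : Fd d) : ℝ) - σ (L.Q x) = t * √(Delta d : ℝ)) : g x x = 2 * t := by
  have h := hg x x
  rw [L.B_self, ← mul_sub, ht, ← mul_assoc] at h
  exact_mod_cast (mul_right_cancel₀ hΔ.ne' h).symm

/-- If `√Δ` is large, the irrational part of `Q` is nonnegative on small combinations of vectors
with small conjugate norms. -/
theorem sum_nonneg (hg : L.IsIrrationalPart σ g) (hpd : L.PosDef)
    (hΔ : 10 ^ 23 < √(Delta d : ℝ)) (u : Fin 4 → L.carrier) (hu : ∀ i, σ (L.Q (u i)) ≤ 31)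
    (x : Fin 4 → ℤ) (hx : ∀ i, |x i| ≤ 10 ^ 9) :
    0 ≤ ∑ i, ∑ j, x i * x j * g (u i) (u j) := by
  have hdiff : ((L.Q (∑ i, (x i : Od d) • u i) : Fd d) : ℝ) - σ (L.Q (∑ i, (x i : Od d) • u i))
      = (∑ i, ∑ j, x i * x j * g (u i) (u j) : ℤ) * √(Delta d : ℝ) / 2 := by
    have h := L.map_Q_sum (realEmbedding d) (fun i => (x i : Od d)) u
    simp only [realEmbedding_apply] at h
    rw [h, L.map_Q_sum σ]
    push_cast
    rw [← Finset.sum_sub_distrib, Finset.sum_mul, Finset.sum_div]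
    refine Finset.sum_congr rfl fun i _ => ?_
    rw [← Finset.sum_sub_distrib, Finset.sum_mul, Finset.sum_div]
    refine Finset.sum_congr rfl fun j _ => ?_
    simp only [map_intCast]
    linear_combination (x i * x j / 2 : ℝ) * hg (u i) (u j)
  have hsmall : ∀ i, σ (L.Q ((x i : Od d) • u i)) ≤ 31 * 10 ^ 18 := by
    intro i
    have h1 : σ (L.Q ((x i : Od d) • u i)) = x i ^ 2 * σ (L.Q (u i)) := by
      simp [coe_Q, Algebra.smul_def]; ring
    have h2 : (x i : ℝ) ^ 2 ≤ (10 ^ 9) ^ 2 := sq_le_sq' (by exact_mod_cast (abs_le.1 (hx i)).1)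
      (by exact_mod_cast (abs_le.1 (hx i)).2)
    rw [h1]
    have := mul_le_mul h2 (hu i) (hpd.map_Q_nonneg σ _) (by positivity)
    linarith
  have hle : σ (L.Q (∑ i, (x i : Od d) • u i)) ≤ 22 * (31 * 10 ^ 18) := by
    rw [Fin.sum_univ_four]
    have h1 := hpd.map_Q_add_le σ ((x 0 : Od d) • u 0 + (x 1 : Od d) • u 1 + (x 2 : Od d) • u 2)
      ((x 3 : Od d) • u 3)
    have h2 := hpd.map_Q_add_le σ ((x 0 : Od d) • u 0 + (x 1 : Od d) • u 1) ((x 2 : Od d) • u 2)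
    have h3 := hpd.map_Q_add_le σ ((x 0 : Od d) • u 0) ((x 1 : Od d) • u 1)
    linarith [hsmall 0, hsmall 1, hsmall 2, hsmall 3]
  by_contra! hneg
  have h1 : ((∑ i, ∑ j, x i * x j * g (u i) (u j) : ℤ) : ℝ) ≤ -1 := by
    exact_mod_cast Int.le_sub_one_of_lt hneg
  have h2 : (0 : ℝ) ≤ (L.Q (∑ i, (x i : Od d) • u i) : Fd d) := hpd.map_Q_nonneg (realEmbedding d) _
  nlinarith

theorem eq_zero_of_self_eq_zero (hg : L.IsIrrationalPart σ g) (hpd : L.PosDef)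
    (hΔ : 10 ^ 23 < √(Delta d : ℝ)) {x y : L.carrier} (hx : σ (L.Q x) ≤ 31)
    (hy : σ (L.Q y) ≤ 31) (hxx : g x x = 0) (hyy : g y y ≤ 62) : g x y = 0 := by
  have key : ∀ c : ℤ, |c| ≤ 10 ^ 9 → 0 ≤ 2 * c * g x y + g y y := by
    intro c hc
    have h := hg.sum_nonneg hpd hΔ ![x, y, x, x] (by simp [Fin.forall_fin_succ, hx, hy])
      ![c, 1, 0, 0] (by simpa [Fin.forall_fin_succ] using hc)
    simp [Fin.sum_univ_four, hxx, hg.symm (lt_trans (by positivity) hΔ) y x] at h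
    linarith
  have h1 := key 32 (by norm_num)
  have h2 := key (-32) (by norm_num)
  omega

end IsIrrationalPart

/-- A family of vectors of a positive definite lattice which consists of two parts, the first
having rational inner products with all vectors and being independent over `ℝ`, and the second
having an irrational part which is positive definite, is linearly independent. -/
theorem PosDef.linearIndependent_sumElim (hpd : L.PosDef) {σ : Fd d →ₐ[ℚ] ℝ}
    (hσ : IsConjugation σ) {g : L.carrier → L.carrier → ℤ} (hg : L.IsIrrationalPart σ g)
    (hΔ : 0 < √(Delta d : ℝ)) {ι κ : Type*} [Fintype ι] [Fintype κ] (v : ι → L.carrier)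
    (w : κ → L.carrier) (hvv : ∀ i j, g (v i) (v j) = 0) (hvw : ∀ i j, g (v i) (w j) = 0)
    (hv : ∀ y : ι → ℝ, y ≠ 0 → 0 < ∑ i, ∑ j, y i * y j * (L.B (v i) (v j) : ℝ))
    (hw : ∀ y : κ → ℝ, y ≠ 0 → 0 < ∑ i, ∑ j, y i * y j * (g (w i) (w j) : ℝ)) :
    LinearIndependent (Od d) (Sum.elim v w) := by
  have coe_eq_zero : ∀ b : Od d, ((b : Fd d) : ℝ) = 0 → b = 0 := fun b hb =>
    NumberField.RingOfIntegers.coe_eq_zero_iff.1 (Subtype.ext hb)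
  rw [Fintype.linearIndependent_iff]
  intro a ha
  have hτ := L.map_Q_sum (realEmbedding d) a (Sum.elim v w)
  rw [ha, coe_Q, map_zero, map_zero] at hτ
  simp only [realEmbedding_apply] at hτ
  choose T hT using fun i => exists_int_add_conj hσ (a i)
  have hconj : ∀ i, σ (((T i : Od d) - a i : Od d) : Fd d) = ((a i : Fd d) : ℝ) := by
    intro i
    have := hT i
    simp; linarith
  have hnn := hpd.map_Q_nonneg σ (∑ i, ((T i : Od d) - a i) • Sum.elim v w i)
  rw [L.map_Q_sum σ] at hnn
  simp only [hconj] at hnn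
  have hdiff : ∑ i, ∑ j, ((a i : Fd d) : ℝ) * ((a j : Fd d) : ℝ)
      * (L.B (Sum.elim v w i) (Sum.elim v w j) : ℝ)
      - ∑ i, ∑ j, ((a i : Fd d) : ℝ) * ((a j : Fd d) : ℝ)
      * σ (L.B (Sum.elim v w i) (Sum.elim v w j))
      = (∑ i, ∑ j, ((a (.inr i) : Fd d) : ℝ) * ((a (.inr j) : Fd d) : ℝ) * (g (w i) (w j) : ℝ))
        * √(Delta d : ℝ) / 2 := by
    have hwv : ∀ i j, g (w j) (v i) = 0 := fun i j => by rw [hg.symm hΔ, hvw]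
    have : ∑ i, ∑ j, ((a (.inr i) : Fd d) : ℝ) * ((a (.inr j) : Fd d) : ℝ) * (g (w i) (w j) : ℝ)
        = ∑ i, ∑ j, ((a i : Fd d) : ℝ) * ((a j : Fd d) : ℝ)
          * (g (Sum.elim v w i) (Sum.elim v w j) : ℝ) := by
      simp [Fintype.sum_sum_type, hvv, hvw, hwv]
    rw [this, ← Finset.sum_sub_distrib, Finset.sum_mul, Finset.sum_div]
    refine Finset.sum_congr rfl fun i _ => ?_
    rw [← Finset.sum_sub_distrib, Finset.sum_mul, Finset.sum_div]
    refine Finset.sum_congr rfl fun j _ => ?_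
    linear_combination (((a i : Fd d) : ℝ) * ((a j : Fd d) : ℝ) / 2)
      * hg (Sum.elim v w i) (Sum.elim v w j)
  have hr : ∀ i, a (.inr i) = 0 := by
    by_contra! hne
    obtain ⟨i, hi⟩ := hne
    have h := hw (fun i => ((a (.inr i) : Fd d) : ℝ)) fun h => hi (coe_eq_zero _ (congrFun h i))
    have h := mul_pos h hΔ
    rw [← hτ] at hdiff
    linarith
  have hr' : ∀ i, ((a (.inr i) : Fd d) : ℝ) = 0 := fun i => by rw [hr i]; simp
  have hl : ∀ i, a (.inl i) = 0 := by
    by_contra! hne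
    obtain ⟨i, hi⟩ := hne
    refine (hv (fun i => ((a (.inl i) : Fd d) : ℝ))
      fun h => hi (coe_eq_zero _ (congrFun h i))).ne ?_
    simpa only [Fintype.sum_sum_type, hr', Sum.elim_inl, zero_mul, mul_zero,
      Finset.sum_const_zero, add_zero] using hτ
  exact Sum.rec hl hr

theorem PosDef.eight_le_rank_of_universal (hd : Squarefree d) (h1 : 1 < d)
    (hΔ : 10 ^ 23 < √(Delta d : ℝ)) (hpd : L.PosDef) (hun : L.Universal) :
    8 ≤ Module.rank (Od d) L.carrier := by
  obtain ⟨σ, hσ⟩ := exists_isConjugation (irrational_sqrt_of_squarefree hd h1)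
  obtain ⟨g, hg⟩ := L.exists_isIrrationalPart hd hσ
  have hΔ0 : 0 < √(Delta d : ℝ) := lt_trans (by positivity) hΔ
  have represents : ∀ x : Od d, TotPos (x : Fd d) → ∃ v, L.Q v = x := fun x hx =>
    (Set.ext_iff.1 hun x).2 (.inl hx)
  have hv : ∀ t : ℕ, ∃ v, t ∈ Finset.Icc 1 31 → L.Q v = t := fun t => by
    by_cases ht : t ∈ Finset.Icc 1 31
    · obtain ⟨v, hv⟩ := represents t (totPos_natCast (Finset.mem_Icc.1 ht).1)
      exact ⟨v, fun _ => hv⟩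
    · exact ⟨0, fun h => absurd h ht⟩
  choose v hv using hv
  have hw : ∀ t : ℕ, ∃ w, ((L.Q w : Fd d) : ℝ) - σ (L.Q w) = t * √(Delta d : ℝ) ∧
      σ (L.Q w) ≤ 1 := fun t => by
    obtain ⟨x, hx, h⟩ := exists_totPos_sub_conj_eq hσ t
    obtain ⟨w, rfl⟩ := represents x hx
    exact ⟨w, h⟩
  choose w hw hw1 using hw
  have hv31 : ∀ t ∈ Finset.Icc 1 31, σ (L.Q (v t)) ≤ 31 := fun t ht => by
    rw [hv t ht]
    have := (Finset.mem_Icc.1 ht).2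
    simpa using this
  have hw31 : ∀ t, σ (L.Q (w t)) ≤ 31 := fun t => (hw1 t).trans (by norm_num)
  have gv : ∀ t ∈ Finset.Icc 1 31, g (v t) (v t) = 0 := fun t ht =>
    hg.self_eq (t := 0) hΔ0 (by rw [hv t ht]; simp)
  have gw : ∀ t, g (w t) (w t) = 2 * t := fun t => hg.self_eq hΔ0 (hw t)
  have gvv : ∀ s ∈ Finset.Icc 1 31, ∀ t ∈ Finset.Icc 1 31, g (v s) (v t) = 0 := fun s hs t ht =>
    hg.eq_zero_of_self_eq_zero hpd hΔ (hv31 s hs) (hv31 t ht) (gv s hs) (by rw [gv t ht]; norm_num)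
  have gvw : ∀ s ∈ Finset.Icc 1 31, ∀ t ∈ Finset.Icc 1 31, g (v s) (w t) = 0 := fun s hs t ht =>
    hg.eq_zero_of_self_eq_zero hpd hΔ (hv31 s hs) (hw31 t) (gv s hs) (by
      rw [gw t]
      have := (Finset.mem_Icc.1 ht).2
      omega)
  obtain ⟨h, hh⟩ : ∃ h : ℕ → ℕ → ℤ, ∀ s t, h s t = ⌊2 * (L.B (v s) (v t) : ℝ)⌋ :=
    ⟨_, fun _ _ => rfl⟩
  have hB : ∀ s ∈ Finset.Icc 1 31, ∀ t ∈ Finset.Icc 1 31,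
      (h s t : ℝ) = 2 * (L.B (v s) (v t) : ℝ) := by
    intro s hs t ht
    obtain ⟨b, hb⟩ := L.exists_two_mul_B_eq (v s) (v t)
    have hb' : ((b : Fd d) : ℝ) = 2 * (L.B (v s) (v t) : ℝ) := by
      rw [hb]; push_cast; ring
    obtain ⟨n, hn⟩ := exists_int_of_conj_eq_s2 hσ (x := b) (by
      have := hg (v s) (v t)
      rw [gvv s hs t ht] at this
      rw [hb', hb, map_add]
      simp at this
      linarith)
    rw [hh, ← hb', hn, Int.floor_intCast]
  obtain ⟨p, hp, hppos⟩ := exists_four_posDef h (fun s t => by rw [hh, hh, L.B_symm])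
    (fun t ht => by
      have := hB t ht t ht
      rw [L.B_self, hv t ht] at this
      simp at this
      exact_mod_cast this)
    (fun t ht x _ => by
      have h1 := hpd.map_Q_nonneg (realEmbedding d) (∑ i, (x i : Od d) • v (t i))
      rw [L.map_Q_sum] at h1
      have h2 : ((∑ i, ∑ j, x i * x j * h (t i) (t j) : ℤ) : ℝ) = 2 * ∑ i, ∑ j,
          realEmbedding d ((x i : Od d) : Fd d) * realEmbedding d ((x j : Od d) : Fd d)
            * realEmbedding d (L.B (v (t i)) (v (t j))) := by
        push_cast
        simp only [Finset.mul_sum]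
        refine Finset.sum_congr rfl fun i _ => Finset.sum_congr rfl fun j _ => ?_
        rw [hB _ (ht i) _ (ht j)]
        simp [realEmbedding_apply]; ring
      have h3 : (0 : ℝ) ≤ ((∑ i, ∑ j, x i * x j * h (t i) (t j) : ℤ) : ℝ) := by
        rw [h2]; positivity
      exact_mod_cast h3)
  obtain ⟨q, hq, hqpos⟩ := exists_four_posDef (fun s t => g (w s) (w t))
    (fun s t => hg.symm hΔ0 _ _) (fun t _ => gw t)
    (fun t _ x hx => hg.sum_nonneg hpd hΔ (fun i => w (t i)) (fun i => hw31 _) x hx)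
  have hli := hpd.linearIndependent_sumElim hσ hg hΔ0 (fun i => v (p i)) (fun i => w (q i))
    (fun i j => gvv _ (hp i) _ (hp j)) (fun i j => gvw _ (hp i) _ (hq j))
    (fun y hy => by
      have h1 := hppos y hy
      have h2 : ∑ i, ∑ j, y i * y j * (h (p i) (p j) : ℝ) =
          2 * ∑ i, ∑ j, y i * y j * (L.B (v (p i)) (v (p j)) : ℝ) := by
        simp only [Finset.mul_sum]
        refine Finset.sum_congr rfl fun i _ => Finset.sum_congr rfl fun j _ => ?_
        rw [hB _ (hp i) _ (hp j)]; ring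
      linarith)
    hqpos
  have := hli.cardinal_le_rank
  rw [Cardinal.mk_fintype] at this
  simpa using this

end QuadLattice

/-- **Theorem (Statement 2).** If `d` is a squarefree positive integer with
discriminant `Δ_d > 576283867731072000000005²`, then there is no positive
definite (possibly non-classic) universal quadratic `𝒪_F`-lattice of rank 7
over `F = ℚ(√d)`. -/
theorem no_universal_lattice_of_rank_seven
    (d : ℕ) (hd : Squarefree d) (hdpos : 0 < d)
    (hΔ : 576283867731072000000005 ^ 2 < Delta d)
    (L : QuadLattice d) (hpd : L.PosDef) (hun : L.Universal) :
    Module.rank (Od d) L.carrier ≠ 7 := by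
  have hΔ' : (10 : ℝ) ^ 23 < √(Delta d : ℝ) := by
    refine Real.lt_sqrt_of_sq_lt ?_
    have : (10 ^ 23) ^ 2 < Delta d := lt_trans (by norm_num) hΔ
    exact_mod_cast this
  have h1 : 1 < d := by
    by_contra! h
    have : Delta d ≤ 4 := by unfold Delta; split_ifs <;> omega
    exact absurd (hΔ.trans_le this) (by norm_num)
  intro h
  have := QuadLattice.PosDef.eight_le_rank_of_universal hd h1 hΔ' hpd hun
  rw [h] at this
  exact absurd this (by norm_num)
end
end

section
/- Let d be a squarefree positive integer with discriminant Δ_d > 4·15², let F = ℚ(√d), and let L be a positive definite classic universal quadratic 𝒪_F-lattice. Then there exist four linearly independent vectors v₁', v₂', v₃', v₄' ∈ L such that Q(vᵢ') ∈ ℤ with 1 ≤ Q(vᵢ') ≤ 15 for each i. -/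
noncomputable section

/-- If `q² d` is an integer for a rational number `q` and a squarefree `d`, then `q` is itself
an integer. -/
theorem Rat.exists_int_eq_of_sq_mul_squarefree {d : ℕ} (hd : Squarefree d) {q : ℚ} {e : ℤ}
    (h : q ^ 2 * d = e) : ∃ k : ℤ, q = k := by
  have hnum : q.num ^ 2 * (d : ℤ) = e * (q.den : ℤ) ^ 2 := by
    have hq : (q.den : ℚ) ≠ 0 := by exact_mod_cast q.den_ne_zero
    have h' : (q.num / q.den : ℚ) ^ 2 * d = e := by rw [Rat.num_div_den]; exact h
    field_simp at h'
    rw [mul_comm e]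
    exact_mod_cast h'
  have hcop : IsCoprime ((q.den : ℤ) ^ 2) (q.num ^ 2) := by
    apply IsCoprime.pow
    rw [Int.isCoprime_iff_gcd_eq_one, Int.gcd_comm]
    exact q.reduced
  have hdvd : (q.den : ℤ) ^ 2 ∣ d := hcop.dvd_of_dvd_mul_left ⟨e, by rw [hnum]; ring⟩
  have hunit : q.den = 1 := by
    have h2 : q.den * q.den ∣ d := by
      rw [← pow_two]; exact_mod_cast hdvd
    exact Nat.isUnit_iff.mp (hd _ h2)
  exact ⟨q.num, ((Rat.den_eq_one_iff q).mp hunit).symm⟩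

/-- A rational number that is integral over `ℤ` inside `ℝ` is an integer. -/
theorem Rat.exists_int_eq_of_isIntegral_real {q : ℚ} (h : IsIntegral ℤ (q : ℝ)) :
    ∃ k : ℤ, q = k := by
  have h' : IsIntegral ℤ q := (isIntegral_algebraMap_iff (algebraMap ℚ ℝ).injective).mp h
  obtain ⟨k, hk⟩ := IsIntegrallyClosed.isIntegral_iff.mp h'
  exact ⟨k, by simpa using hk.symm⟩

theorem Squarefree.not_isSquare_ratCast {d : ℕ} (hd : Squarefree d) (hd1 : 1 < d) :
    ¬ IsSquare (d : ℚ) := by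
  rw [Rat.isSquare_natCast_iff]
  rintro ⟨k, rfl⟩
  have := Nat.isUnit_iff.mp (hd k dvd_rfl)
  simp [this] at hd1

/-- The generator `√d` of `ℚ(√d)`. -/
def sqrtFd (d : ℕ) : Fd d := ⟨Real.sqrt d, IntermediateField.mem_adjoin_simple_self ℚ _⟩

/-- The inclusion `ℚ(√d) ⊆ ℝ` as an embedding. -/
def inclFd (d : ℕ) : Fd d →ₐ[ℚ] ℝ := (algebraMap (Fd d) ℝ).toRatAlgHom

theorem inclFd_apply {d : ℕ} (x : Fd d) : inclFd d x = (x : ℝ) := rfl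

theorem exists_conj_algHom {d : ℕ} (hd : Squarefree d) (hd1 : 1 < d) :
    ∃ σ : Fd d →ₐ[ℚ] ℝ, σ (sqrtFd d) = -Real.sqrt d := by
  have hsq : Real.sqrt d ^ 2 = d := Real.sq_sqrt (Nat.cast_nonneg d)
  have hirr : Irreducible (Polynomial.X ^ 2 - Polynomial.C (d : ℚ)) :=
    X_pow_sub_C_irreducible_of_prime Nat.prime_two fun b hb =>
      hd.not_isSquare_ratCast hd1 ⟨b, by rw [← hb, pow_two]⟩
  have hmin : minpoly ℚ (Real.sqrt d) = Polynomial.X ^ 2 - Polynomial.C (d : ℚ) :=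
    (minpoly.eq_of_irreducible_of_monic hirr (by simp [hsq])
      (Polynomial.monic_X_pow_sub_C _ two_ne_zero)).symm
  have hint : IsIntegral ℚ (Real.sqrt d) :=
    ⟨_, Polynomial.monic_X_pow_sub_C (d : ℚ) two_ne_zero, by simp [hsq]⟩
  have hroot : Polynomial.aeval (-Real.sqrt d)
      (minpoly ℚ (IntermediateField.adjoin.powerBasis hint).gen) = 0 := by
    have hgen : minpoly ℚ (IntermediateField.adjoin.powerBasis hint).gen =
        minpoly ℚ (Real.sqrt d) := by
      rw [IntermediateField.adjoin.powerBasis_gen]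
      exact IntermediateField.minpoly_gen ℚ _
    rw [hgen, hmin]
    simp [hsq]
  exact ⟨(IntermediateField.adjoin.powerBasis hint).lift _ hroot,
    (IntermediateField.adjoin.powerBasis hint).lift_gen _ hroot⟩

theorem exists_rat_coords {d : ℕ} (x : Fd d) :
    ∃ a b : ℚ, x = algebraMap ℚ (Fd d) a + algebraMap ℚ (Fd d) b * sqrtFd d := by
  have hsq : Real.sqrt d * Real.sqrt d = d := Real.mul_self_sqrt (Nat.cast_nonneg d)
  suffices h : ∃ a b : ℚ, (x : ℝ) = a + b * Real.sqrt d by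
    obtain ⟨a, b, h⟩ := h
    exact ⟨a, b, Subtype.ext (by simpa [sqrtFd] using h)⟩
  have hint : IsIntegral ℚ (Real.sqrt d) :=
    ⟨_, Polynomial.monic_X_pow_sub_C (d : ℚ) two_ne_zero, by simp [pow_two, hsq]⟩
  have hx : (x : ℝ) ∈ Algebra.adjoin ℚ {Real.sqrt d} := by
    rw [← IntermediateField.adjoin_simple_toSubalgebra_of_isAlgebraic hint.isAlgebraic]
    exact x.2
  generalize (x : ℝ) = r at hx
  induction hx using Algebra.adjoin_induction with
  | mem y hy => exact ⟨0, 1, by simpa using hy⟩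
  | algebraMap r => exact ⟨r, 0, by simp⟩
  | add y z _ _ hy hz =>
    obtain ⟨a, b, rfl⟩ := hy
    obtain ⟨a', b', rfl⟩ := hz
    exact ⟨a + a', b + b', by push_cast; ring⟩
  | mul y z _ _ hy hz =>
    obtain ⟨a, b, rfl⟩ := hy
    obtain ⟨a', b', rfl⟩ := hz
    exact ⟨a * a' + b * b' * d, a * b' + b * a', by
      push_cast; linear_combination (b * b' : ℝ) * hsq⟩

/-- If `Δ_d > 4 c²`, an algebraic integer of `ℚ(√d)` whose conjugates all have absolute value at most
`c` is a rational integer. -/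
theorem exists_int_eq_of_isIntegral_of_sq_le {d : ℕ} (hd : Squarefree d) (hd1 : 1 < d) {c : ℕ}
    (hΔ : 4 * c ^ 2 < Delta d) {x : Fd d} (hx : IsIntegral ℤ x)
    (hle : ∀ σ : Fd d →ₐ[ℚ] ℝ, σ x ^ 2 ≤ (c : ℝ) ^ 2) : ∃ k : ℤ, x = k := by
  have hsq : Real.sqrt d * Real.sqrt d = d := Real.mul_self_sqrt (Nat.cast_nonneg d)
  obtain ⟨a, b, rfl⟩ := exists_rat_coords x
  obtain ⟨σ, hσ⟩ := exists_conj_algHom hd hd1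
  set x : Fd d := algebraMap ℚ (Fd d) a + algebraMap ℚ (Fd d) b * sqrtFd d with hxdef
  have h₁ : inclFd d x = a + b * Real.sqrt d := by
    simp [hxdef, sqrtFd, inclFd_apply]
  have h₂ : σ x = a - b * Real.sqrt d := by
    simp [hxdef, hσ, sub_eq_add_neg]
  have hle₁ := hle (inclFd d)
  have hle₂ := hle σ
  have hi₁ : IsIntegral ℤ (inclFd d x) := hx.map ((inclFd d).restrictScalars ℤ)
  have hi₂ : IsIntegral ℤ (σ x) := hx.map (σ.restrictScalars ℤ)
  rw [h₁] at hle₁ hi₁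
  rw [h₂] at hle₂ hi₂
  obtain ⟨t, ht⟩ : ∃ t : ℤ, 2 * a = t := by
    apply Rat.exists_int_eq_of_isIntegral_real
    have h : ((2 * a : ℚ) : ℝ) = (a + b * Real.sqrt d) + (a - b * Real.sqrt d) := by
      push_cast; ring
    rw [h]
    exact hi₁.add hi₂
  obtain ⟨n, hn⟩ : ∃ n : ℤ, a ^ 2 - b ^ 2 * d = n := by
    apply Rat.exists_int_eq_of_isIntegral_real
    have h : ((a ^ 2 - b ^ 2 * d : ℚ) : ℝ) =
        (a + b * Real.sqrt d) * (a - b * Real.sqrt d) := by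
      push_cast; linear_combination (b ^ 2 : ℝ) * hsq
    rw [h]
    exact hi₁.mul hi₂
  obtain ⟨k, hk⟩ : ∃ k : ℤ, 2 * b = k := by
    apply Rat.exists_int_eq_of_sq_mul_squarefree hd (e := t ^ 2 - 4 * n)
    push_cast
    rw [← ht, ← hn]; ring
  have hdisc : k ^ 2 * d = t ^ 2 - 4 * n := by
    have : (k : ℚ) ^ 2 * d = t ^ 2 - 4 * n := by rw [← ht, ← hn, ← hk]; ring
    exact_mod_cast this
  have hbound : k ^ 2 * d ≤ 4 * (c : ℤ) ^ 2 := by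
    have h4 : ((2 * b : ℚ) : ℝ) ^ 2 * d ≤ 4 * (c : ℝ) ^ 2 := by
      push_cast
      nlinarith [sq_nonneg (a : ℝ)]
    rw [hk] at h4
    exact_mod_cast h4
  have hk0 : k = 0 := by
    by_contra hk0
    unfold Delta at hΔ
    split_ifs at hΔ with hmod
    · have : 1 ≤ k ^ 2 := by have := sq_pos_of_ne_zero hk0; omega
      have : (4 * c ^ 2 : ℤ) < d := by exact_mod_cast hΔ
      nlinarith
    · have hmod0 : d % 4 ≠ 0 := fun h0 => by
        have := Nat.isUnit_iff.mp (hd 2 (Nat.dvd_of_mod_eq_zero h0))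
        omega
      have hkeven : Even k := by
        by_contra hodd
        rw [Int.not_even_iff_odd] at hodd
        obtain ⟨j, rfl⟩ := hodd
        have hdz : (d : ℤ) % 4 = 2 ∨ (d : ℤ) % 4 = 3 := by omega
        have hkd : ((2 * j + 1) ^ 2 * d : ℤ) % 4 = d % 4 := by
          have : ((2 * j + 1) ^ 2 * d : ℤ) = d + 4 * ((j ^ 2 + j) * d) := by ring
          omega
        have ht4 : t ^ 2 % 4 = 0 ∨ t ^ 2 % 4 = 1 := by
          rcases Int.even_or_odd' t with ⟨s, rfl | rfl⟩
          · left; ring_nf; omega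
          · right; ring_nf; omega
        omega
      obtain ⟨j, rfl⟩ := hkeven
      have : 1 ≤ j ^ 2 := by
        have : j ≠ 0 := by rintro rfl; simp at hk0
        have := sq_pos_of_ne_zero this
        omega
      have : (4 * c ^ 2 : ℤ) < 4 * d := by exact_mod_cast hΔ
      nlinarith
  have hb : b = 0 := by simpa [hk0] using hk
  rw [hb] at hi₁
  obtain ⟨m, hm⟩ := Rat.exists_int_eq_of_isIntegral_real (q := a) (by simpa using hi₁)
  exact ⟨m, by simp [hxdef, hb, hm]⟩

namespace QuadLattice

variable {d : ℕ} (L : QuadLattice d)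

theorem B_add_right (x y z : L.carrier) : L.B x (y + z) = L.B x y + L.B x z := by
  rw [L.B_symm, L.B_add_left, L.B_symm y, L.B_symm z]

theorem B_smul_right (a : Od d) (x y : L.carrier) : L.B x (a • y) = (a : Fd d) * L.B x y := by
  rw [L.B_symm, L.B_smul_left, L.B_symm]

theorem B_zero_left (x : L.carrier) : L.B 0 x = 0 := by
  simpa using L.B_smul_left 0 0 x

theorem B_sum_left {ι : Type*} (s : Finset ι) (f : ι → L.carrier) (x : L.carrier) :
    L.B (∑ i ∈ s, f i) x = ∑ i ∈ s, L.B (f i) x :=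
  map_sum (AddMonoidHom.mk' (fun y => L.B y x) fun y z => L.B_add_left y z x) f s

variable {L}

theorem PosDef.nonneg (hpd : L.PosDef) (x : L.carrier) (σ : Fd d →ₐ[ℚ] ℝ) :
    0 ≤ σ (L.B x x) := by
  by_cases hx : x = 0
  · simp [hx, B_zero_left]
  · rw [L.B_self]
    exact (hpd x hx σ).le

/-- The Cauchy–Schwarz inequality under each embedding, for classic lattices. -/
theorem PosDef.sq_le (hcl : L.IsClassic) (hpd : L.PosDef) {v w : L.carrier} {m n : ℤ} (hn : 0 < n)
    (hv : L.B v v = m) (hw : L.B w w = n) (σ : Fd d →ₐ[ℚ] ℝ) : σ (L.B v w) ^ 2 ≤ m * n := by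
  have hint : IsIntegral ℤ (L.B v w) := hcl v w
  let b : Od d := ⟨L.B v w, hint⟩
  have hb : (b : Fd d) = L.B v w := rfl
  have hQ : L.B ((n : Od d) • v + (-b) • w) ((n : Od d) • v + (-b) • w) =
      n * (m * n - L.B v w ^ 2) := by
    simp only [B_add_right, L.B_add_left, B_smul_right, L.B_smul_left, hv, hw, L.B_symm w v,
      map_neg, map_intCast, hb]
    ring
  have h0 := hpd.nonneg ((n : Od d) • v + (-b) • w) σ
  rw [hQ] at h0
  simp only [map_mul, map_sub, map_pow, map_intCast] at h0
  have hn' : (0 : ℝ) < n := by exact_mod_cast hn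
  linarith [nonneg_of_mul_nonneg_right h0 hn']

theorem exists_int_B_eq (hd : Squarefree d) (hd1 : 1 < d) {c : ℕ} (hΔ : 4 * c ^ 2 < Delta d)
    (hcl : L.IsClassic) (hpd : L.PosDef) {v w : L.carrier} {m n : ℤ} (hm : 0 < m) (hmc : m ≤ c)
    (hn : 0 < n) (hnc : n ≤ c) (hv : L.B v v = m) (hw : L.B w w = n) :
    ∃ k : ℤ, L.B v w = k := by
  refine exists_int_eq_of_isIntegral_of_sq_le hd hd1 hΔ (hcl v w) fun σ => ?_
  refine (hpd.sq_le hcl hn hv hw σ).trans ?_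
  have : m * n ≤ (c : ℤ) ^ 2 := by nlinarith
  exact_mod_cast this

theorem Universal.exists_B_eq (hun : L.Universal) {n : ℤ} (hn : 0 < n) :
    ∃ v, L.B v v = n := by
  have hmem : (n : Od d) ∈ {a : Od d | TotPos (a : Fd d)} ∪ {0} := by
    left
    intro σ
    simpa using hn
  rw [← hun] at hmem
  obtain ⟨v, hv⟩ := hmem
  exact ⟨v, by simpa [L.B_self] using congrArg (algebraMap (Od d) (Fd d)) hv⟩

/-- Positivity of an integral Gram form in three vectors. -/
theorem PosDef.gram_three_nonneg_s11 (hpd : L.PosDef) {v₁ v₂ v₃ : L.carrier}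
    {g₁₁ g₂₂ g₃₃ g₁₂ g₁₃ g₂₃ : ℤ} (h₁₁ : L.B v₁ v₁ = g₁₁) (h₂₂ : L.B v₂ v₂ = g₂₂)
    (h₃₃ : L.B v₃ v₃ = g₃₃) (h₁₂ : L.B v₁ v₂ = g₁₂) (h₁₃ : L.B v₁ v₃ = g₁₃)
    (h₂₃ : L.B v₂ v₃ = g₂₃) (a b c : ℤ) :
    0 ≤ a ^ 2 * g₁₁ + b ^ 2 * g₂₂ + c ^ 2 * g₃₃ +
      2 * (a * b * g₁₂ + a * c * g₁₃ + b * c * g₂₃) := by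
  have h := hpd.nonneg ((a : Od d) • v₁ + (b : Od d) • v₂ + (c : Od d) • v₃) (inclFd d)
  have hQ : L.B ((a : Od d) • v₁ + (b : Od d) • v₂ + (c : Od d) • v₃)
      ((a : Od d) • v₁ + (b : Od d) • v₂ + (c : Od d) • v₃) =
      ((a ^ 2 * g₁₁ + b ^ 2 * g₂₂ + c ^ 2 * g₃₃ +
        2 * (a * b * g₁₂ + a * c * g₁₃ + b * c * g₂₃) : ℤ) : Fd d) := by
    simp only [B_add_right, L.B_add_left, B_smul_right, L.B_smul_left, h₁₁, h₂₂, h₃₃, h₁₂, h₁₃, h₂₃,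
      L.B_symm v₂ v₁, L.B_symm v₃ v₁, L.B_symm v₃ v₂, map_intCast]
    push_cast
    ring
  rw [hQ, map_intCast] at h
  exact_mod_cast h

/-- Vectors with nonsingular integral Gram matrix are linearly independent. -/
theorem linearIndependent_of_det_ne_zero {ι : Type*} [Fintype ι] [DecidableEq ι]
    (v : ι → L.carrier) (G : Matrix ι ι ℤ) (hG : ∀ i j, L.B (v i) (v j) = G i j)
    (hdet : G.det ≠ 0) : LinearIndependent (Od d) v := by
  rw [Fintype.linearIndependent_iff]
  intro a ha
  have hdet' : (G.map (Int.cast : ℤ → Fd d)).det ≠ 0 := by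
    rw [← Int.cast_det]
    exact_mod_cast hdet
  have hvec : Matrix.vecMul (fun i => (a i : Fd d)) (G.map (Int.cast : ℤ → Fd d)) = 0 := by
    ext1 j
    have h := congrArg (fun x => L.B x (v j)) ha
    simpa [B_sum_left, B_zero_left, L.B_smul_left, hG, Matrix.vecMul, dotProduct] using h
  intro i
  have := congrFun (Matrix.eq_zero_of_vecMul_eq_zero hdet' hvec) i
  exact NumberField.RingOfIntegers.ext (by simpa using this)

end QuadLattice

/-- The form `k D x² + D y² + z²` misses `k D t` as soon as it does so on a finite box. -/
theorem forall_sub_sq_ne_zero {D k t : ℕ} (hD : 0 < D) (hD' : D ≤ 10) (hk : 0 < k) (hk' : k ≤ 2)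
    (ht : t ≤ 14)
    (hfin : ∀ p < 4, ∀ q < 6, ∀ w < 17, D * (k * p ^ 2 + q ^ 2) + w ^ 2 ≠ k * D * t) (p q w : ℤ) :
    (D : ℤ) * (k * (t - p ^ 2) - q ^ 2) - w ^ 2 ≠ 0 := by
  intro h
  rw [← Int.natAbs_sq p, ← Int.natAbs_sq q, ← Int.natAbs_sq w] at h
  generalize p.natAbs = p at h
  generalize q.natAbs = q at h
  generalize w.natAbs = w at h
  have h' : D * (k * p ^ 2 + q ^ 2) + w ^ 2 = k * D * t := by
    zify
    linear_combination -h
  have hkt : k * t ≤ 28 := by nlinarith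
  have hs : k * p ^ 2 + q ^ 2 ≤ k * t := by
    refine Nat.le_of_mul_le_mul_left ?_ hD
    nlinarith
  have hp : p ^ 2 ≤ t := by
    refine Nat.le_of_mul_le_mul_left ?_ hk
    omega
  have hw : w ^ 2 ≤ 280 := by nlinarith
  exact hfin p (by nlinarith) q (by nlinarith) w (by nlinarith) h'

theorem exists_truant_of_one_one {D : ℤ} (h : D = 1 ∨ D = 2 ∨ D = 3) :
    ∃ t : ℤ, 0 < t ∧ t ≤ 15 ∧ ∀ p q w : ℤ, D * (t - p ^ 2 - q ^ 2) - w ^ 2 ≠ 0 := by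
  have of_box : ∀ D t : ℕ, 0 < D → D ≤ 10 → 0 < t → t ≤ 14 →
      (∀ p < 4, ∀ q < 6, ∀ w < 17, D * (1 * p ^ 2 + q ^ 2) + w ^ 2 ≠ 1 * D * t) →
      ∃ t : ℤ, 0 < t ∧ t ≤ 15 ∧ ∀ p q w : ℤ, D * (t - p ^ 2 - q ^ 2) - w ^ 2 ≠ 0 := by
    intro D t hD hD' ht ht' hfin
    refine ⟨t, by omega, by omega, fun p q w => ?_⟩
    simpa using forall_sub_sq_ne_zero hD hD' one_pos one_le_two ht' hfin p q w
  rcases h with rfl | rfl | rfl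
  · exact of_box 1 7 (by simp) (by simp) (by simp) (by simp) (by decide)
  · exact of_box 2 14 (by simp) (by simp) (by simp) (by simp) (by decide)
  · exact of_box 3 6 (by simp) (by simp) (by simp) (by simp) (by decide)

theorem exists_truant_of_one_two {D : ℤ}
    (h : D = 1 ∨ D = 2 ∨ D = 4 ∨ D = 6 ∨ D = 7 ∨ D = 8 ∨ D = 9 ∨ D = 10) :
    ∃ t : ℤ, 0 < t ∧ t ≤ 15 ∧ ∀ p q w : ℤ, D * (2 * (t - p ^ 2) - q ^ 2) - w ^ 2 ≠ 0 := by
  have of_box : ∀ D t : ℕ, 0 < D → D ≤ 10 → 0 < t → t ≤ 14 →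
      (∀ p < 4, ∀ q < 6, ∀ w < 17, D * (2 * p ^ 2 + q ^ 2) + w ^ 2 ≠ 2 * D * t) →
      ∃ t : ℤ, 0 < t ∧ t ≤ 15 ∧ ∀ p q w : ℤ, D * (2 * (t - p ^ 2) - q ^ 2) - w ^ 2 ≠ 0 := by
    intro D t hD hD' ht ht' hfin
    refine ⟨t, by omega, by omega, fun p q w => ?_⟩
    exact forall_sub_sq_ne_zero hD hD' two_pos le_rfl ht' hfin p q w
  rcases h with rfl | rfl | rfl | rfl | rfl | rfl | rfl | rfl
  · exact of_box 1 7 (by simp) (by simp) (by simp) (by simp) (by decide)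
  · exact of_box 2 14 (by simp) (by simp) (by simp) (by simp) (by decide)
  · exact of_box 4 7 (by simp) (by simp) (by simp) (by simp) (by decide)
  · exact of_box 6 10 (by simp) (by simp) (by simp) (by simp) (by decide)
  · exact of_box 7 7 (by simp) (by simp) (by simp) (by simp) (by decide)
  · exact of_box 8 14 (by simp) (by simp) (by simp) (by simp) (by decide)
  · exact of_box 9 7 (by simp) (by simp) (by simp) (by simp) (by decide)
  · exact of_box 10 10 (by simp) (by simp) (by simp) (by simp) (by decide)

theorem three_sub_mem (x y : ℤ) (h : 0 ≤ 3 - x ^ 2 - y ^ 2) :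
    3 - x ^ 2 - y ^ 2 = 1 ∨ 3 - x ^ 2 - y ^ 2 = 2 ∨ 3 - x ^ 2 - y ^ 2 = 3 := by
  rw [← Int.natAbs_sq x, ← Int.natAbs_sq y] at *
  generalize x.natAbs = x at *
  generalize y.natAbs = y at *
  have hx : x < 2 := by zify; nlinarith
  have hy : y < 2 := by zify; nlinarith
  interval_cases x <;> interval_cases y <;> simp

theorem ten_sub_mem (x y : ℤ) (h : 0 ≤ 10 - 2 * x ^ 2 - y ^ 2) :
    let D := 10 - 2 * x ^ 2 - y ^ 2
    D = 1 ∨ D = 2 ∨ D = 4 ∨ D = 6 ∨ D = 7 ∨ D = 8 ∨ D = 9 ∨ D = 10 := by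
  rw [← Int.natAbs_sq x, ← Int.natAbs_sq y] at *
  generalize x.natAbs = x at *
  generalize y.natAbs = y at *
  have hx : x < 3 := by zify; nlinarith
  have hy : y < 4 := by zify; nlinarith
  interval_cases x <;> interval_cases y <;> simp at h ⊢

theorem Matrix.det_fin_four_symm {R : Type*} [CommRing R] (a b c e f g h i j k : R) :
    Matrix.det !![a, b, c, e; b, f, g, h; c, g, i, j; e, h, j, k] =
      a * (f * (i * k - j * j) - g * (g * k - j * h) + h * (g * j - i * h)) -
      b * (b * (i * k - j * j) - g * (c * k - j * e) + h * (c * j - i * e)) +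
      c * (b * (g * k - j * h) - f * (c * k - j * e) + h * (c * h - g * e)) -
      e * (b * (g * j - i * h) - f * (c * j - i * e) + g * (c * h - g * e)) := by
  simp [Matrix.det_succ_row_zero, Fin.sum_univ_succ, Fin.succAbove]
  ring

/-- **Lemma (Statement 11).** Let `Δ_d > 4·15²` and let `L` be a positive
definite classic universal quadratic `𝒪_F`-lattice. Then there exist four
linearly independent vectors in `L` whose `Q`-values are rational integers in
`[1, 15]`. -/
theorem exists_four_linearIndependent_small_values
    (d : ℕ) (hd : Squarefree d) (hd1 : 1 < d)
    (hΔ : 4 * 15 ^ 2 < Delta d)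
    (L : QuadLattice d) (hcl : L.IsClassic) (hpd : L.PosDef) (hun : L.Universal) :
    ∃ v : Fin 4 → L.carrier, LinearIndependent (Od d) v ∧
      ∀ i, ∃ n : ℤ, (L.Q (v i) : Fd d) = (n : Fd d) ∧ 1 ≤ n ∧ n ≤ 15 := by
  have pair {v w : L.carrier} {m n : ℤ} (hm : 0 < m ∧ m ≤ 15) (hn : 0 < n ∧ n ≤ 15)
      (hv : L.B v v = m) (hw : L.B w w = n) : ∃ k : ℤ, L.B v w = k :=
    QuadLattice.exists_int_B_eq hd hd1 hΔ hcl hpd hm.1 (by simpa using hm.2) hn.1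
      (by simpa using hn.2) hv hw
  obtain ⟨v₁, h₁⟩ := hun.exists_B_eq (n := 1) (by norm_num)
  obtain ⟨v₂, h₂⟩ := hun.exists_B_eq (n := 2) (by norm_num)
  obtain ⟨b, hb⟩ := pair (by norm_num) (by norm_num) h₁ h₂
  -- It suffices to find a third value whose completions by a suitable fourth value are nonsingular.
  suffices key : ∃ n : ℤ, (0 < n ∧ n ≤ 15) ∧ ∀ v₃, L.B v₃ v₃ = n → ∀ x y : ℤ, L.B v₁ v₃ = x →
      L.B v₂ v₃ = y → ∃ t : ℤ, (0 < t ∧ t ≤ 15) ∧ ∀ p q r : ℤ,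
        Matrix.det !![1, b, x, p; b, 2, y, q; x, y, n, r; p, q, r, t] ≠ 0 by
    obtain ⟨n, hn, key⟩ := key
    obtain ⟨v₃, h₃⟩ := hun.exists_B_eq hn.1
    obtain ⟨x, hx⟩ := pair (by norm_num) hn h₁ h₃
    obtain ⟨y, hy⟩ := pair (by norm_num) hn h₂ h₃
    obtain ⟨t, ht, hdet⟩ := key v₃ h₃ x y hx hy
    obtain ⟨v₄, h₄⟩ := hun.exists_B_eq ht.1
    obtain ⟨p, hp⟩ := pair (by norm_num) ht h₁ h₄
    obtain ⟨q, hq⟩ := pair (by norm_num) ht h₂ h₄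
    obtain ⟨r, hr⟩ := pair hn ht h₃ h₄
    refine ⟨![v₁, v₂, v₃, v₄],
      QuadLattice.linearIndependent_of_det_ne_zero _ _ ?_ (hdet p q r), ?_⟩
    · intro i j
      fin_cases i <;> fin_cases j <;>
        simp [h₁, h₂, h₃, h₄, hb, hx, hy, hp, hq, hr, L.B_symm v₂ v₁, L.B_symm v₃ v₁,
          L.B_symm v₄ v₁, L.B_symm v₃ v₂, L.B_symm v₄ v₂, L.B_symm v₄ v₃]
    · intro i
      fin_cases i
      · exact ⟨1, (L.B_self v₁).symm.trans h₁, by norm_num, by norm_num⟩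
      · exact ⟨2, (L.B_self v₂).symm.trans h₂, by norm_num, by norm_num⟩
      · exact ⟨n, (L.B_self v₃).symm.trans h₃, hn.1, hn.2⟩
      · exact ⟨t, (L.B_self v₄).symm.trans h₄, ht.1, ht.2⟩
  have hb2 : b ^ 2 ≤ 2 := by
    have h := hpd.sq_le hcl (by norm_num) h₁ h₂ (inclFd d)
    rw [hb, map_intCast] at h
    exact_mod_cast (by simpa using h : (b : ℝ) ^ 2 ≤ 2)
  have hb' : b = 0 ∨ b ^ 2 = 1 := by
    have h1 : -2 < b := by nlinarith
    have h2 : b < 2 := by nlinarith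
    interval_cases b <;> simp
  rcases hb' with rfl | hb'
  · refine ⟨5, by norm_num, fun v₃ h₃ x y hx hy => ?_⟩
    have hpos := hpd.gram_three_nonneg_s11 h₁ h₂ h₃ hb hx hy (-2 * x) (-y) 2
    have hD : 0 ≤ 10 - 2 * x ^ 2 - y ^ 2 := by linarith
    obtain ⟨t, ht, ht', hne⟩ := exists_truant_of_one_two (D := 10 - 2 * x ^ 2 - y ^ 2)
      (ten_sub_mem x y hD)
    refine ⟨t, ⟨ht, ht'⟩, fun p q r hdet => hne p q (2 * (r - x * p) - y * q) ?_⟩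
    rw [Matrix.det_fin_four_symm] at hdet
    linear_combination 2 * hdet
  · refine ⟨3, by norm_num, fun v₃ h₃ x y hx hy => ?_⟩
    have hpos := hpd.gram_three_nonneg_s11 h₁ h₂ h₃ hb hx hy (-x + (y - b * x) * b) (-(y - b * x)) 1
    obtain ⟨z, hz⟩ : ∃ z, z = y - b * x := ⟨_, rfl⟩
    obtain rfl : y = z + b * x := by linarith
    have hD : 0 ≤ 3 - x ^ 2 - z ^ 2 := by
      linear_combination hpos - z ^ 2 * hb'
    obtain ⟨t, ht, ht', hne⟩ := exists_truant_of_one_one (D := 3 - x ^ 2 - z ^ 2)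
      (three_sub_mem x z hD)
    refine ⟨t, ⟨ht, ht'⟩, fun p q r hdet => hne p (q - b * p) (r - x * p - z * (q - b * p)) ?_⟩
    rw [Matrix.det_fin_four_symm] at hdet
    have hb1 : b = 1 ∨ b = -1 := by simpa using hb'
    rcases hb1 with rfl | rfl <;> linear_combination hdet
end
end
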